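/- arXiv:2307.00256 — 2 statements merged into one kernel-verified Lean document; each statement's English description precedes it below -/
import Mathlib

section
/- Assume the Riemann hypothesis. Fix y > 0 and δ ∈ (1/2, 1). Then the limit as X → ∞ of P̃₊(y, X, δ) := (log X / X^δ) · Σ_{N prime, X ≤ N ≤ X + X^δ} Σ_{χ ∈ D₊(N)} χ(⌈yX⌉^𝔭)/τ(χ) exists and equals cos(2πy). -/
open Filter Topology Finset

/-- The Riemann hypothesis: every zero of the Riemann zeta function with real part
strictly between `0` and `1` has real part `1/2`. -/
def RiemannHypothesis' : Prop :=
  ∀ s : ℂ, riemannZeta s = 0 → 0 < s.re → s.re < 1 → s.re = 1 / 2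

/-- `⌈x⌉^𝔭`: the smallest prime number that is `≥ x`. -/
noncomputable def leastPrime (x : ℝ) : ℕ := sInf {p : ℕ | p.Prime ∧ x ≤ (p : ℝ)}

/-- The Gauss sum `τ(χ) = Σ_{b=1}^{N} χ(b) e^{2πib/N}`. -/
noncomputable def gaussSum' {N : ℕ} (χ : DirichletCharacter ℂ N) : ℂ :=
  ∑ b ∈ Finset.Icc 1 N,
    χ ((b : ℕ) : ZMod N) * Complex.exp (2 * Real.pi * Complex.I * (b : ℂ) / (N : ℂ))

/-- `P̃₊(y, X, δ)`. -/
noncomputable def PplusTilde (y X δ : ℝ) : ℂ :=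
  (Complex.ofReal (Real.log X / X ^ δ)) *
    ∑ N ∈ (Finset.range (Nat.floor (X + X ^ δ) + 1)).filter
        (fun N : ℕ => N.Prime ∧ X ≤ (N : ℝ) ∧ (N : ℝ) ≤ X + X ^ δ),
      ∑ᶠ χ ∈ {χ : DirichletCharacter ℂ N | χ.IsPrimitive ∧ χ (-1) = 1},
        χ ((leastPrime (y * X) : ℕ) : ZMod N) / gaussSum' χ

/-- The function `t ↦ {t}` on `(1, ∞)`, extended by zero. -/
noncomputable def fractTail : ℝ → ℂ := (Set.Ioi (1 : ℝ)).indicator fun t ↦ ((Int.fract t : ℝ) : ℂ)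

lemma norm_fractTail_le (t : ℝ) : ‖fractTail t‖ ≤ 1 := by
  unfold fractTail
  refine (norm_indicator_le_norm_self _ _).trans ?_
  simp only [Complex.norm_real, Real.norm_eq_abs, abs_of_nonneg (Int.fract_nonneg t)]
  exact (Int.fract_lt_one t).le

lemma measurable_fractTail : Measurable fractTail := by
  unfold fractTail
  exact (Complex.measurable_ofReal.comp measurable_fract).indicator measurableSet_Ioi

lemma differentiableAt_mellin_fractTail {s : ℂ} (hs : s.re < 0) :
    DifferentiableAt ℂ (mellin fractTail) s := by
  refine mellin_differentiableAt_of_isBigO_rpow (a := 0) (b := s.re - 1) ?_ ?_ hs ?_ (by linarith)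
  · refine MeasureTheory.LocallyIntegrable.locallyIntegrableOn ?_ _
    exact (MeasureTheory.locallyIntegrable_const (1 : ℂ)).mono
      measurable_fractTail.aestronglyMeasurable (.of_forall fun t ↦ by
        simpa using norm_fractTail_le t)
  · refine .of_bound 1 (.of_forall fun t ↦ ?_)
    simpa using norm_fractTail_le t
  · refine .of_bound 0 ?_
    filter_upwards [mem_nhdsWithin_of_mem_nhds (Iio_mem_nhds (zero_lt_one' ℝ))] with t ht
    have : t ∉ Set.Ioi (1 : ℝ) := by simp at ht ⊢; exact ht.le
    simp [fractTail, this]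

lemma mellin_fractTail (s : ℂ) :
    mellin fractTail s = ∫ t in Set.Ioi (1 : ℝ), (t : ℂ) ^ (s - 1) * ((Int.fract t : ℝ) : ℂ) := by
  unfold mellin fractTail
  rw [← MeasureTheory.integral_indicator measurableSet_Ioi,
    ← MeasureTheory.integral_indicator measurableSet_Ioi]
  congr 1 with t
  by_cases h : 1 < t
  · have : 0 < t := by linarith
    simp [h, this]
  · simp [Set.indicator, h]

lemma norm_mellin_fractTail_le {s : ℂ} (hs : s.re < 0) :
    ‖mellin fractTail s‖ ≤ 1 / (-s.re) := by
  rw [mellin_fractTail]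
  have h := integral_Ioi_rpow_of_lt (a := s.re - 1) (by linarith) (zero_lt_one' ℝ)
  have h2 : 1 / (-s.re) = ∫ t in Set.Ioi (1 : ℝ), t ^ (s.re - 1) := by
    rw [h]; simp; ring
  rw [h2]
  refine MeasureTheory.norm_integral_le_of_norm_le
    (integrableOn_Ioi_rpow_of_lt (by linarith) zero_lt_one) ?_
  refine (MeasureTheory.ae_restrict_iff' measurableSet_Ioi).2 (.of_forall fun t ht ↦ ?_)
  have ht0 : (0 : ℝ) < t := zero_lt_one.trans ht
  rw [norm_mul, Complex.norm_cpow_eq_rpow_re_of_pos ht0, Complex.norm_real, Real.norm_eq_abs,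
    abs_of_nonneg (Int.fract_nonneg t)]
  simpa using mul_le_mul_of_nonneg_left (Int.fract_lt_one t).le (Real.rpow_nonneg ht0.le (s.re - 1))

lemma riemannZeta_eq_mellin_fractTail {s : ℂ} (hs : 1 < s.re) :
    riemannZeta s = s / (s - 1) - s * mellin fractTail (-s) := by
  have h0 : s - 1 ≠ 0 := by
    intro h; have := congrArg Complex.re h; simp at this; linarith
  have h1 := LSeries_eq_mul_integral' (fun _ ↦ (1 : ℂ)) (r := 1) zero_le_one hs (by
    simp only [norm_one, sum_const, Nat.card_Icc, add_tsub_cancel_right, Real.rpow_one]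
    simpa using Asymptotics.isBigO_refl (fun n : ℕ ↦ (n : ℝ)) atTop)
  have h2 : LSeries (fun _ ↦ (1 : ℂ)) s = riemannZeta s := LSeries_one_eq_riemannZeta hs
  rw [← h2, h1, mellin_fractTail]
  have h3 : ∫ t in Set.Ioi (1 : ℝ), (t : ℂ) ^ (-s) = 1 / (s - 1) := by
    rw [integral_Ioi_cpow_of_lt (by simpa using hs) zero_lt_one]
    have : -s + 1 ≠ 0 := by intro h; apply h0; linear_combination -h
    simp; field_simp; ring
  have i1 : MeasureTheory.IntegrableOn (fun t : ℝ ↦ (t : ℂ) ^ (-s)) (Set.Ioi 1) :=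
    integrableOn_Ioi_cpow_of_lt (by simpa using hs) zero_lt_one
  have i2 : MeasureTheory.IntegrableOn (fun t : ℝ ↦ (t : ℂ) ^ (-s - 1) * ((Int.fract t : ℝ) : ℂ))
      (Set.Ioi 1) := by
    refine MeasureTheory.Integrable.mul_bdd (c := 1)
      (integrableOn_Ioi_cpow_of_lt (by simp; linarith) zero_lt_one) ?_ ?_
    · exact (Complex.measurable_ofReal.comp measurable_fract).aestronglyMeasurable
    · refine .of_forall fun t ↦ ?_
      rw [Complex.norm_real, Real.norm_eq_abs, abs_of_nonneg (Int.fract_nonneg t)]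
      exact (Int.fract_lt_one t).le
  rw [div_eq_mul_one_div, ← h3, ← mul_sub, ← MeasureTheory.integral_sub i1 i2]
  congr 1
  refine MeasureTheory.setIntegral_congr_fun measurableSet_Ioi fun t ht ↦ ?_
  have ht0 : (0 : ℝ) < t := zero_lt_one.trans ht
  have ht0' : (t : ℂ) ≠ 0 := by exact_mod_cast ht0.ne'
  have e1 : ((⌊t⌋₊ : ℕ) : ℂ) = t - (Int.fract t : ℝ) := by
    have : ((⌊t⌋₊ : ℕ) : ℝ) = t - Int.fract t := by
      rw [natCast_floor_eq_intCast_floor ht0.le, Int.self_sub_fract]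
    exact_mod_cast this
  have e2 : (t : ℂ) ^ (-s) = t ^ (-s - 1) * t := by
    rw [Complex.cpow_sub _ _ ht0', Complex.cpow_one, div_mul_cancel₀ _ ht0']
  simp only [sum_const, Nat.card_Icc, add_tsub_cancel_right, nsmul_eq_mul, mul_one]
  rw [e1, e2, show -(s + 1) = -s - 1 by ring]
  ring

lemma riemannZeta₁_eq_mellin_fractTail {s : ℂ} (hs : 0 < s.re) :
    riemannZeta₁ s = s - s * (s - 1) * mellin fractTail (-s) := by
  have hU : IsOpen {s : ℂ | 0 < s.re} := isOpen_lt continuous_const Complex.continuous_re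
  have hd : DifferentiableOn ℂ (fun s ↦ s - s * (s - 1) * mellin fractTail (-s))
      {s : ℂ | 0 < s.re} := by
    intro z hz
    have : DifferentiableAt ℂ (fun s ↦ mellin fractTail (-s)) z :=
      DifferentiableAt.comp (g := mellin fractTail) z
        (differentiableAt_mellin_fractTail (s := -z) (by simpa using hz)) differentiableAt_id.neg
    exact (by fun_prop : DifferentiableAt ℂ _ z).differentiableWithinAt
  refine AnalyticOnNhd.eqOn_of_preconnected_of_eventuallyEq
    (differentiable_riemannZeta₁.differentiableOn.analyticOnNhd hU) (hd.analyticOnNhd hU)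
    ((convex_halfSpace_re_gt 0).isPreconnected) (z₀ := 2) (by simp) ?_ hs
  have : {s : ℂ | 1 < s.re} ∈ 𝓝 (2 : ℂ) :=
    (isOpen_lt continuous_const Complex.continuous_re).mem_nhds (by simp)
  filter_upwards [this] with z hz
  have h0 : z - 1 ≠ 0 := by
    intro h; have := congrArg Complex.re h; simp at this; have : 1 < z.re := hz; linarith
  have h1 := riemannZeta_eq_inv_sub_mul (sub_ne_zero.1 h0)
  rw [riemannZeta_eq_mellin_fractTail hz] at h1
  field_simp at h1
  linear_combination -h1

lemma norm_riemannZeta₁_le {s : ℂ} (hs : 1 / 2 ≤ s.re) :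
    ‖riemannZeta₁ s‖ ≤ 3 * (‖s‖ + 1) ^ 2 := by
  have hs0 : 0 < s.re := by linarith
  rw [riemannZeta₁_eq_mellin_fractTail hs0]
  have h1 : ‖mellin fractTail (-s)‖ ≤ 2 := by
    refine (norm_mellin_fractTail_le (by simpa using hs0)).trans ?_
    rw [div_le_iff₀ (by simpa using hs0)]; simp; linarith
  have h2 : ‖s - 1‖ ≤ ‖s‖ + 1 := (norm_sub_le _ _).trans (by simp)
  calc _ ≤ ‖s‖ + ‖s‖ * ‖s - 1‖ * ‖mellin fractTail (-s)‖ := by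
        refine (norm_sub_le _ _).trans (by simp)
    _ ≤ ‖s‖ + ‖s‖ * (‖s‖ + 1) * 2 := by gcongr
    _ ≤ _ := by nlinarith [norm_nonneg s]

lemma norm_logDeriv_le_of_norm_le {f : ℂ → ℂ} {c z : ℂ} {r R b B : ℝ} (hrR : r < R)
    (hf : DifferentiableOn ℂ f (Metric.ball c R)) (hf0 : ∀ w ∈ Metric.ball c R, f w ≠ 0)
    (hB : ∀ w ∈ Metric.ball c R, ‖f w‖ ≤ B) (hb : 0 < b) (hbc : b ≤ ‖f c‖)
    (hz : z ∈ Metric.closedBall c r) :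
    ‖logDeriv f z‖ ≤ 8 * R / (R - r) ^ 2 * (Real.log (B / b) + 1) := by
  have hr : 0 ≤ r := dist_nonneg.trans (Metric.mem_closedBall.1 hz)
  have hR : 0 < R := hr.trans_lt hrR
  have hcR : c ∈ Metric.ball c R := Metric.mem_ball_self hR
  have hB0 : b ≤ B := hbc.trans (hB c hcR)
  set M := Real.log (B / b) + 1 with hM
  have hM0 : 0 < M := by
    have : 0 ≤ Real.log (B / b) := Real.log_nonneg (by rwa [one_le_div hb])
    linarith
  have hO : IsOpen (Metric.ball c R) := Metric.isOpen_ball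
  have hL : DifferentiableOn ℂ (logDeriv f) (Metric.ball c R) := (hf.deriv hO).div hf hf0
  obtain ⟨g, hgc, hg⟩ := hL.isExactOn_ball.with_val_at c 0
  have hconst : ∀ w ∈ Metric.ball c R, f w * Complex.exp (-g w) = f c := by
    intro w hw
    have key := hO.is_const_of_deriv_eq_zero (𝕜 := ℂ)
      (f := fun w ↦ f w * Complex.exp (-g w)) (convex_ball c R).isPreconnected ?_ ?_ hw hcR
    · simpa [hgc] using key
    · intro u hu
      have h1 := (hf u hu).differentiableAt (hO.mem_nhds hu)
      exact (h1.mul (hg u hu).neg.cexp.differentiableAt).differentiableWithinAt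
    · intro u hu
      have h1 := ((hf u hu).differentiableAt (hO.mem_nhds hu)).hasDerivAt
      have h2 := h1.mul (hg u hu).neg.cexp
      refine h2.deriv.trans ?_
      have := hf0 u hu
      simp only [logDeriv_apply, Pi.zero_apply, Pi.neg_apply]
      field_simp
      ring
  have hre : ∀ w ∈ Metric.ball c R, (g w).re ≤ M := by
    intro w hw
    have h1 : f w = f c * Complex.exp (g w) := by
      rw [← hconst w hw, mul_assoc, ← Complex.exp_add]; simp
    have h2 := hB w hw
    rw [h1, norm_mul, Complex.norm_exp] at h2
    have h3 : Real.exp (g w).re ≤ B / b := by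
      rw [le_div_iff₀ hb, mul_comm]
      exact (mul_le_mul_of_nonneg_right hbc (Real.exp_pos _).le).trans h2
    have := (Real.le_log_iff_exp_le (div_pos (hb.trans_le hB0) hb)).2 h3
    linarith
  have hbd : ∀ w ∈ Metric.ball c R, ‖g w‖ ≤ 2 * M * ‖w - c‖ / (R - ‖w - c‖) := by
    intro w hw
    have := Complex.borelCaratheodory_zero (f := fun u ↦ g (c + u)) (z := w - c) hM0 ?_ ?_ hR
      (by simpa [dist_eq_norm] using hw) (by simpa using hgc)
    · simpa using this
    · intro u hu
      have hu' : c + u ∈ Metric.ball c R := by simpa using hu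
      exact ((hg _ hu').differentiableAt.comp u (by fun_prop)).differentiableWithinAt
    · intro u hu
      exact hre _ (by simpa using hu)
  have hρ : 0 < (R - r) / 2 := by linarith
  have hzr : ‖z - c‖ ≤ r := by simpa [dist_eq_norm] using hz
  have hsub : Metric.closedBall z ((R - r) / 2) ⊆ Metric.ball c R := by
    intro w hw
    have h1 : ‖w - z‖ ≤ (R - r) / 2 := by simpa [dist_eq_norm] using hw
    have h2 : ‖w - c‖ ≤ ‖w - z‖ + ‖z - c‖ := by simpa using norm_add_le (w - z) (z - c)
    rw [mem_ball_iff_norm]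
    linarith
  have hd : deriv g z = logDeriv f z :=
    (hg z (hsub (Metric.mem_closedBall_self hρ.le))).deriv
  rw [← hd]
  have hfin := Complex.norm_deriv_le_of_forall_mem_sphere_norm_le (f := g) (c := z)
    (C := 4 * M * R / (R - r)) hρ ?_ ?_
  · refine hfin.trans_eq ?_
    have : R - r ≠ 0 := by linarith
    field_simp
    ring
  · refine DifferentiableOn.diffContOnCl fun w hw ↦ ?_
    have hw' := hsub (Metric.closure_ball_subset_closedBall hw)
    exact (hg w hw').differentiableAt.differentiableWithinAt
  · intro w hw
    have hw' : w ∈ Metric.ball c R := hsub (Metric.sphere_subset_closedBall hw)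
    refine (hbd w hw').trans ?_
    have h1 : ‖w - z‖ = (R - r) / 2 := by simpa [dist_eq_norm] using hw
    have h2 : ‖w - c‖ ≤ ‖w - z‖ + ‖z - c‖ := by simpa using norm_add_le (w - z) (z - c)
    have h3 : (R - r) / 2 ≤ R - ‖w - c‖ := by linarith
    have h4 : ‖w - c‖ ≤ R := by linarith
    calc _ ≤ 2 * M * R / ((R - r) / 2) := by gcongr
      _ = _ := by field_simp; ring

lemma exists_le_norm_riemannZeta₁_two_add :
    ∃ b : ℝ, 0 < b ∧ b ≤ 1 ∧ ∀ t : ℝ, b ≤ ‖riemannZeta₁ (2 + t * Complex.I)‖ := by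
  set K : ℝ := ∑' n, ‖LSeries.term 1 2 n‖ with hK
  have hsum : Summable fun n ↦ ‖LSeries.term 1 2 n‖ :=
    (LSeriesSummable_one_iff.2 (by norm_num : 1 < (2 : ℂ).re)).norm
  have hmain : ∀ t : ℝ, 1 ≤ ‖riemannZeta₁ (2 + t * Complex.I)‖ * K := by
    intro t
    set s : ℂ := 2 + t * Complex.I with hs
    have hsre : s.re = 2 := by simp [hs]
    have hs1 : 1 < s.re := by rw [hsre]; norm_num
    have h1 := ArithmeticFunction.LSeries_zeta_mul_Lseries_moebius hs1
    rw [ArithmeticFunction.LSeries_zeta_eq_riemannZeta hs1] at h1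
    have hle : ∀ n, ‖LSeries.term (fun n ↦ ((ArithmeticFunction.moebius n : ℤ) : ℂ)) s n‖
        ≤ ‖LSeries.term 1 2 n‖ := by
      intro n
      rw [LSeries.norm_term_eq, LSeries.norm_term_eq]
      split_ifs with hn
      · rfl
      · rw [hsre]
        have : ‖((ArithmeticFunction.moebius n : ℤ) : ℂ)‖ ≤ 1 := by
          rw [Complex.norm_intCast]
          exact_mod_cast ArithmeticFunction.abs_moebius_le_one
        simp only [Pi.one_apply, norm_one, Complex.re_ofNat]
        gcongr
    have h2 : ‖LSeries (fun n ↦ ((ArithmeticFunction.moebius n : ℤ) : ℂ)) s‖ ≤ K :=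
      tsum_of_norm_bounded hsum.hasSum hle
    have hs0 : s ≠ 1 := fun h ↦ by rw [h] at hs1; simp at hs1
    have h3 : ‖riemannZeta s‖ ≤ ‖riemannZeta₁ s‖ := by
      rw [riemannZeta_eq_inv_sub_mul hs0, norm_mul, norm_inv]
      have : 1 ≤ ‖s - 1‖ := by
        refine le_trans ?_ (Complex.abs_re_le_norm _)
        simp [hsre]; norm_num
      exact mul_le_of_le_one_left (norm_nonneg _) (inv_le_one_of_one_le₀ this)
    calc (1 : ℝ) = ‖riemannZeta s‖ *
          ‖LSeries (fun n ↦ ((ArithmeticFunction.moebius n : ℤ) : ℂ)) s‖ := by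
          rw [← norm_mul, h1, norm_one]
      _ ≤ _ := by gcongr
  have hK0 : 0 < K := by
    by_contra! h
    have := hmain 0
    nlinarith [norm_nonneg (riemannZeta₁ (2 + (0 : ℝ) * Complex.I))]
  exact ⟨min (1 / K) 1, by positivity, min_le_right _ _,
    fun t ↦ (min_le_left _ _).trans ((div_le_iff₀ hK0).2 (hmain t))⟩

lemma riemannZeta₁_ne_zero (hRH : RiemannHypothesis') {s : ℂ} (hs : 1 / 2 < s.re) :
    riemannZeta₁ s ≠ 0 := by
  unfold RiemannHypothesis' at hRH
  by_cases h1 : s = 1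
  · simp [h1]
  intro h0
  have hz : riemannZeta s = 0 := by rw [riemannZeta_eq_inv_sub_mul h1, h0, mul_zero]
  rcases lt_or_ge s.re 1 with h | h
  · have := hRH s hz (by linarith) h
    linarith
  · exact riemannZeta_ne_zero_of_one_le_re h hz

lemma exists_norm_logDeriv_riemannZeta₁_le_log (hRH : RiemannHypothesis') {σ : ℝ}
    (hσ : 1 / 2 < σ) (hσ2 : σ < 2) :
    ∃ C : ℝ, 0 < C ∧ ∀ s : ℂ, σ ≤ s.re → s.re ≤ 2 →
      ‖logDeriv riemannZeta₁ s‖ ≤ C * Real.log (|s.im| + 5) := by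
  obtain ⟨b, hb, hb1, hbt⟩ := exists_le_norm_riemannZeta₁_two_add
  have hb12 : b ≤ 12 := by linarith
  set A : ℝ := 8 * (3 / 2) / ((3 / 2) - (2 - σ)) ^ 2 with hA
  have hA0 : 0 < A := by
    have : 0 < (3 / 2) - (2 - σ) := by linarith
    positivity
  have hlb : 0 ≤ Real.log (12 / b) := Real.log_nonneg (by rwa [one_le_div hb])
  refine ⟨A * (Real.log (12 / b) + 3), by positivity, fun s hs1 hs2 ↦ ?_⟩
  set c : ℂ := 2 + s.im * Complex.I with hc
  have hsc : s - c = ((s.re - 2 : ℝ) : ℂ) := by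
    apply Complex.ext <;> simp [hc]
  have h5 : 1 ≤ Real.log (|s.im| + 5) := by
    rw [Real.le_log_iff_exp_le (by positivity)]
    linarith [Real.exp_one_lt_d9, abs_nonneg s.im]
  have hcre : ∀ w ∈ Metric.ball c (3 / 2), 1 / 2 < w.re := by
    intro w hw
    have h1 : ‖w - c‖ < 3 / 2 := by simpa [dist_eq_norm] using hw
    have h2 := (abs_lt.1 ((Complex.abs_re_le_norm (w - c)).trans_lt h1)).1
    simp [hc] at h2
    linarith
  have key := norm_logDeriv_le_of_norm_le (f := riemannZeta₁) (c := c) (z := s) (r := 2 - σ)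
    (R := 3 / 2) (b := b) (B := 12 * (|s.im| + 5) ^ 2) (by linarith)
    differentiable_riemannZeta₁.differentiableOn
    (fun w hw ↦ riemannZeta₁_ne_zero hRH (hcre w hw)) ?_ hb (hbt _) ?_
  · refine key.trans ?_
    have hp : 0 < |s.im| + 5 := by positivity
    have : Real.log (12 * (|s.im| + 5) ^ 2 / b) =
        Real.log (12 / b) + 2 * Real.log (|s.im| + 5) := by
      rw [mul_div_right_comm, Real.log_mul (by positivity) (by positivity), Real.log_pow]
      norm_num
    rw [this, mul_assoc, ← hA]
    gcongr
    nlinarith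
  · intro w hw
    refine (norm_riemannZeta₁_le (hcre w hw).le).trans ?_
    have h1 : ‖w - c‖ < 3 / 2 := by simpa [dist_eq_norm] using hw
    have h2 : ‖c‖ ≤ 2 + |s.im| := (norm_add_le _ _).trans (by simp)
    have h3 : ‖w‖ ≤ ‖w - c‖ + ‖c‖ := by simpa using norm_add_le (w - c) c
    have h4 : ‖w‖ + 1 ≤ |s.im| + 5 := by linarith
    have h6 : (‖w‖ + 1) ^ 2 ≤ (|s.im| + 5) ^ 2 := by gcongr
    linarith [sq_nonneg (|s.im| + 5)]
  · rw [mem_closedBall_iff_norm, hsc, Complex.norm_real, Real.norm_eq_abs, abs_le]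
    constructor <;> linarith

lemma exists_norm_logDeriv_riemannZeta₁_le (hRH : RiemannHypothesis') {σ ε : ℝ}
    (hσ : 1 / 2 < σ) (hσ2 : σ < 2) (hε : 0 < ε) :
    ∃ C : ℝ, 0 < C ∧ ∀ s : ℂ, σ ≤ s.re → s.re ≤ 2 →
      ‖logDeriv riemannZeta₁ s‖ ≤ C * (|s.im| + 5) ^ ε := by
  obtain ⟨C, hC, h⟩ := exists_norm_logDeriv_riemannZeta₁_le_log hRH hσ hσ2
  refine ⟨C / ε, by positivity, fun s h1 h2 ↦ (h s h1 h2).trans ?_⟩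
  rw [div_mul_eq_mul_div, mul_div_assoc]
  gcongr
  exact Real.log_le_rpow_div (by positivity) hε

lemma integrable_of_norm_le_one_add_abs_rpow {h : ℝ → ℂ} (hc : Continuous h) {M r : ℝ}
    (hr : 1 < r) (hM : ∀ t, ‖h t‖ ≤ M * (1 + |t|) ^ (-r)) : MeasureTheory.Integrable h := by
  have h1 : MeasureTheory.Integrable fun t : ℝ ↦ (1 + ‖t‖) ^ (-r) :=
    integrable_one_add_norm (by simpa using hr)
  refine (h1.const_mul M).mono' hc.aestronglyMeasurable (.of_forall fun t ↦ ?_)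
  simpa using hM t

lemma integral_vertical_eq_of_norm_le {H : ℂ → ℂ} {a b M r : ℝ} (hab : a ≤ b) (hr : 1 < r)
    (hd : ∀ s : ℂ, a ≤ s.re → s.re ≤ b → DifferentiableAt ℂ H s)
    (hM : ∀ s : ℂ, a ≤ s.re → s.re ≤ b → ‖H s‖ ≤ M * (1 + |s.im|) ^ (-r)) :
    ∫ t : ℝ, H (a + t * Complex.I) = ∫ t : ℝ, H (b + t * Complex.I) := by
  have hint : ∀ c : ℝ, a ≤ c → c ≤ b →
      MeasureTheory.Integrable fun t : ℝ ↦ H (c + t * Complex.I) := by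
    intro c h1 h2
    refine integrable_of_norm_le_one_add_abs_rpow ?_ hr (M := M) fun t ↦ ?_
    · rw [continuous_iff_continuousAt]
      intro t
      exact ContinuousAt.comp (g := H) (f := fun t : ℝ ↦ (c + t * Complex.I : ℂ))
        (hd _ (by simpa) (by simpa)).continuousAt (by fun_prop)
    · simpa using hM (c + t * Complex.I) (by simpa) (by simpa)
  have hhor : ∀ T : ℝ, ‖∫ x in a..b, H (x + T * Complex.I)‖ ≤ M * (1 + |T|) ^ (-r) * |b - a| := by
    intro T
    refine intervalIntegral.norm_integral_le_of_norm_le_const fun x hx ↦ ?_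
    rw [Set.uIoc_of_le hab] at hx
    simpa using hM (x + T * Complex.I) (by simpa using hx.1.le) (by simpa using hx.2)
  have hlim : Tendsto (fun T : ℝ ↦ M * (1 + |T|) ^ (-r) * |b - a|) atTop (𝓝 0) := by
    have h1 : Tendsto (fun T : ℝ ↦ 1 + |T|) atTop atTop :=
      tendsto_atTop_add_const_left _ _ tendsto_abs_atTop_atTop
    have h2 := (tendsto_rpow_neg_atTop (by linarith : 0 < r)).comp h1
    simpa using (h2.const_mul M).mul_const |b - a|
  have hbot : Tendsto (fun T : ℝ ↦ ∫ x in a..b, H (x + (-T : ℝ) * Complex.I)) atTop (𝓝 0) :=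
    squeeze_zero_norm (fun T ↦ by simpa only [abs_neg] using hhor (-T)) hlim
  have htop : Tendsto (fun T : ℝ ↦ ∫ x in a..b, H (x + T * Complex.I)) atTop (𝓝 0) :=
    squeeze_zero_norm hhor hlim
  have hva := MeasureTheory.intervalIntegral_tendsto_integral (hint a le_rfl hab)
    tendsto_neg_atTop_atBot tendsto_id
  have hvb := MeasureTheory.intervalIntegral_tendsto_integral (hint b hab le_rfl)
    tendsto_neg_atTop_atBot tendsto_id
  have hall := ((hbot.sub htop).add (hvb.const_smul Complex.I)).sub (hva.const_smul Complex.I)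
  have hzero : ∀ T : ℝ, (∫ x in a..b, H (x + (-T : ℝ) * Complex.I)) -
      (∫ x in a..b, H (x + T * Complex.I)) + Complex.I • (∫ y in (-T)..T, H (b + y * Complex.I)) -
      Complex.I • (∫ y in (-T)..T, H (a + y * Complex.I)) = 0 := by
    intro T
    have := Complex.integral_boundary_rect_eq_zero_of_differentiableOn H (a + (-T : ℝ) * Complex.I)
      (b + T * Complex.I) ?_
    · simpa using this
    · intro s hs
      rw [Complex.mem_reProdIm] at hs
      have := hs.1
      simp only [Complex.add_re, Complex.ofReal_re, Complex.mul_re, Complex.I_re, mul_zero,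
        Complex.ofReal_im, Complex.I_im, mul_one, sub_self, add_zero, Set.uIcc_of_le hab] at this
      exact (hd s this.1 this.2).differentiableWithinAt
  have h0 := tendsto_nhds_unique (tendsto_const_nhds.congr fun T ↦ (hzero T).symm) hall
  simp only [sub_self, zero_add, smul_eq_mul] at h0
  exact mul_left_cancel₀ Complex.I_ne_zero (sub_eq_zero.1 h0.symm).symm

lemma one_add_abs_im_le {s : ℂ} (hs : 1 / 2 ≤ s.re) : 1 + |s.im| ≤ 3 * ‖s‖ := by
  have h1 := Complex.abs_im_le_norm s
  have h2 := (le_abs_self _).trans (Complex.abs_re_le_norm s)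
  linarith

lemma HasMellin.congr {f g : ℝ → ℂ} {s m : ℂ} (hf : HasMellin f s m)
    (h : Set.EqOn f g (Set.Ioi 0)) : HasMellin g s m := by
  have h' : Set.EqOn (fun t : ℝ ↦ (t : ℂ) ^ (s - 1) • f t) (fun t : ℝ ↦ (t : ℂ) ^ (s - 1) • g t)
      (Set.Ioi 0) := fun t ht ↦ by simp only [h ht]
  refine ⟨(MeasureTheory.integrableOn_congr_fun h' measurableSet_Ioi).1 hf.1, ?_⟩
  rw [← hf.2]
  exact (MeasureTheory.setIntegral_congr_fun measurableSet_Ioi h').symm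

lemma hasMellin_max_one_sub {s : ℂ} (hs : 0 < s.re) :
    HasMellin (fun t : ℝ ↦ ((max 0 (1 - t) : ℝ) : ℂ)) s (1 / (s * (s + 1))) := by
  have h1 := hasMellin_one_Ioc hs
  have h2 := hasMellin_cpow_Ioc (a := 1) (s := s) (by simp; linarith)
  have h3 := hasMellin_sub h1.1 h2.1
  rw [h1.2, h2.2] at h3
  have e1 : s ≠ 0 := by rintro rfl; simp at hs
  have e2 : s + 1 ≠ 0 := by
    intro h; have := congrArg Complex.re h; simp at this; linarith
  have h4 : 1 / s - 1 / (s + 1) = 1 / (s * (s + 1)) := by field_simp; ring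
  rw [h4] at h3
  refine h3.congr fun t (ht : 0 < t) ↦ ?_
  by_cases h : t ≤ 1
  · simp [Set.indicator, ht, h]
  · simp [Set.indicator, h, (not_le.1 h).le]

lemma hasMellin_max_one_sub_sq_div {s : ℂ} (hs : 1 < s.re) :
    HasMellin (fun t : ℝ ↦ (((max 0 (1 - t)) ^ 2 / (2 * t) : ℝ) : ℂ)) s
      (1 / ((s - 1) * (s * (s + 1)))) := by
  have h0 := hasMellin_cpow_Ioc (a := -1) (s := s) (by simp; linarith)
  have h1 := hasMellin_max_one_sub (s := s) (by linarith)
  have h2 := hasMellin_cpow_Ioc (a := 1) (s := s) (by simp; linarith)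
  have h3 := hasMellin_one_Ioc (s := s) (by linarith)
  have h4 := hasMellin_sub (hasMellin_sub h0.1 h3.1).1 h1.1
  rw [(hasMellin_sub h0.1 h3.1).2, h0.2, h1.2, h3.2] at h4
  have h5 := hasMellin_const_smul h4.1 (1 / 2 : ℂ)
  rw [h4.2] at h5
  have e1 : s ≠ 0 := by rintro rfl; simp at hs; linarith
  have e2 : s + 1 ≠ 0 := by
    intro h; have := congrArg Complex.re h; simp at this; linarith
  have e3 : s - 1 ≠ 0 := by
    intro h; have := congrArg Complex.re h; simp at this; linarith
  have h6 : (1 / 2 : ℂ) • (1 / (s + -1) - 1 / s - 1 / (s * (s + 1))) =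
      1 / ((s - 1) * (s * (s + 1))) := by
    rw [← sub_eq_add_neg, smul_eq_mul]; field_simp; ring
  rw [h6] at h5
  refine h5.congr fun t (ht : 0 < t) ↦ ?_
  have ht' : (t : ℂ) ≠ 0 := by exact_mod_cast ht.ne'
  by_cases h : t ≤ 1
  · simp only [Set.indicator, Set.mem_Ioc, ht, h, and_self, if_true, Complex.cpow_neg_one,
      smul_eq_mul, max_eq_right (sub_nonneg.2 h)]
    push_cast
    field_simp
  · simp [Set.indicator, h, (not_le.1 h).le]

lemma integral_cpow_mul_eq_of_hasMellin {f : ℝ → ℂ} {m : ℂ → ℂ} {σ x : ℝ} (hx : 0 < x)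
    (hm : ∀ t : ℝ, HasMellin f (σ + t * Complex.I) (m (σ + t * Complex.I)))
    (hi : MeasureTheory.Integrable fun t : ℝ ↦ m (σ + t * Complex.I))
    (hc : ContinuousAt f x⁻¹) :
    ∫ t : ℝ, (x : ℂ) ^ (σ + t * Complex.I) * m (σ + t * Complex.I) = 2 * Real.pi * f x⁻¹ := by
  have h0 := (hm 0).1
  simp only [Complex.ofReal_zero, zero_mul, add_zero] at h0
  have hv : Complex.VerticalIntegrable (mellin f) σ := by
    refine hi.congr (.of_forall fun t ↦ ?_)
    exact (hm t).2.symm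
  have := mellinInv_mellin_eq σ f (inv_pos.2 hx) h0 hv hc
  rw [← this, mellinInv]
  have hpi : (Real.pi : ℂ) ≠ 0 := by exact_mod_cast Real.pi_ne_zero
  rw [Complex.real_smul]
  push_cast
  rw [← mul_assoc, mul_one_div_cancel (by simp [hpi]), one_mul]
  congr 1
  ext t
  rw [(hm t).2, smul_eq_mul]
  congr 1
  rw [Complex.cpow_neg, Complex.inv_cpow, inv_inv]
  rw [Complex.arg_ofReal_of_nonneg hx.le]
  exact Real.pi_ne_zero.symm

lemma norm_one_div_mul_add_one_le {s : ℂ} (hs : 1 / 2 ≤ s.re) :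
    ‖1 / (s * (s + 1))‖ ≤ 9 * (1 + |s.im|) ^ (-2 : ℝ) := by
  have h1 := one_add_abs_im_le hs
  have h2 := one_add_abs_im_le (s := s + 1) (by simp; linarith)
  simp only [Complex.add_im, Complex.one_im, add_zero] at h2
  have h0 : 0 < 1 + |s.im| := by positivity
  rw [norm_div, norm_mul, norm_one, Real.rpow_neg h0.le, Real.rpow_two, ← div_eq_mul_inv,
    div_le_div_iff₀ (by nlinarith) (by positivity)]
  nlinarith

lemma continuous_one_div_mul_add_one {σ : ℝ} (hσ : 0 < σ) :
    Continuous fun t : ℝ ↦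
      1 / ((σ + t * Complex.I : ℂ) * ((σ + t * Complex.I : ℂ) + 1)) := by
  refine continuous_const.div (by fun_prop) fun t ↦ mul_ne_zero ?_ ?_ <;> intro h <;>
    have := congrArg Complex.re h <;> simp at this <;> linarith

lemma integrable_one_div_mul_add_one {σ : ℝ} (hσ : 1 / 2 ≤ σ) :
    MeasureTheory.Integrable fun t : ℝ ↦
      1 / ((σ + t * Complex.I : ℂ) * ((σ + t * Complex.I : ℂ) + 1)) := by
  refine integrable_of_norm_le_one_add_abs_rpow (continuous_one_div_mul_add_one (by linarith))
    (M := 9) one_lt_two fun t ↦ ?_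
  simpa using norm_one_div_mul_add_one_le (s := σ + t * Complex.I) (by simpa using hσ)

lemma integral_cpow_mul_LSeries_vonMangoldt {x : ℝ} (hx : 0 < x) :
    ∫ t : ℝ, (x : ℂ) ^ ((2 : ℝ) + t * Complex.I : ℂ) *
      LSeries (fun n ↦ (ArithmeticFunction.vonMangoldt n : ℂ)) ((2 : ℝ) + t * Complex.I) *
      (1 / (((2 : ℝ) + t * Complex.I : ℂ) * (((2 : ℝ) + t * Complex.I : ℂ) + 1))) =
    2 * Real.pi *
      ((∑' n : ℕ, ArithmeticFunction.vonMangoldt n * max 0 (1 - n / x) : ℝ) : ℂ) := by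
  set P : ℝ → ℂ := fun t ↦
    1 / (((2 : ℝ) + t * Complex.I : ℂ) * (((2 : ℝ) + t * Complex.I : ℂ) + 1)) with hP
  have hPi : MeasureTheory.Integrable P := integrable_one_div_mul_add_one (by norm_num)
  have hPc : Continuous P := continuous_one_div_mul_add_one (by norm_num)
  set Λ : ℕ → ℂ := fun n ↦ (ArithmeticFunction.vonMangoldt n : ℂ) with hΛ
  have hx' : (x : ℂ) ≠ 0 := by exact_mod_cast hx.ne'
  set G : ℕ → ℝ → ℂ := fun n t ↦ (x : ℂ) ^ ((2 : ℝ) + t * Complex.I : ℂ) *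
    LSeries.term Λ ((2 : ℝ) + t * Complex.I) n * P t with hG
  have hnorm : ∀ n t, ‖G n t‖ = x ^ (2 : ℝ) * ‖LSeries.term Λ 2 n‖ * ‖P t‖ := by
    intro n t
    simp only [hG, norm_mul, Complex.norm_cpow_eq_rpow_re_of_pos hx, LSeries.norm_term_eq]
    simp
  have hcont : ∀ n, Continuous (G n) := by
    intro n
    refine (Continuous.mul ?_ ?_).mul hPc
    · exact Continuous.const_cpow (by fun_prop) (Or.inl hx')
    · rcases eq_or_ne n 0 with rfl | hn
      · simpa using continuous_const
      · simp only [LSeries.term_of_ne_zero hn]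
        refine continuous_const.div ?_ ?_
        · exact Continuous.const_cpow (by fun_prop) (Or.inl (by exact_mod_cast hn))
        · intro t
          simp [Complex.cpow_eq_zero_iff, hn]
  have hint : ∀ n, MeasureTheory.Integrable (G n) := by
    intro n
    exact (hPi.norm.const_mul (x ^ (2 : ℝ) * ‖LSeries.term Λ 2 n‖)).mono'
      (hcont n).aestronglyMeasurable (.of_forall fun t ↦ (hnorm n t).le)
  have hS : Summable fun n ↦ ∫ t, ‖G n t‖ := by
    simp only [hnorm, MeasureTheory.integral_const_mul]
    refine Summable.mul_right _ (Summable.mul_left _ ?_)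
    exact (ArithmeticFunction.LSeriesSummable_vonMangoldt (by norm_num : 1 < (2 : ℂ).re)).norm
  have hsum := MeasureTheory.hasSum_integral_of_summable_integral_norm hint hS
  have hval : ∀ n, ∫ t, G n t = 2 * Real.pi *
      ((ArithmeticFunction.vonMangoldt n * max 0 (1 - n / x) : ℝ) : ℂ) := by
    intro n
    rcases eq_or_ne n 0 with rfl | hn
    · simp [hG]
    have hn0 : (0 : ℝ) < n := by positivity
    have h1 := integral_cpow_mul_eq_of_hasMellin (σ := 2) (div_pos hx hn0)
      (fun t ↦ hasMellin_max_one_sub (s := (2 : ℝ) + t * Complex.I) (by simp))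
      (m := fun s ↦ 1 / (s * (s + 1))) hPi (by fun_prop)
    have h2 : ∀ t, G n t = Λ n * (((x / n : ℝ) : ℂ) ^ ((2 : ℝ) + t * Complex.I : ℂ) * P t) := by
      intro t
      simp only [hG, LSeries.term_of_ne_zero hn]
      rw [Complex.ofReal_div, Complex.div_cpow_ofReal_nonneg hx.le hn0.le]
      push_cast
      ring
    simp only [h2, MeasureTheory.integral_const_mul]
    rw [h1, inv_div]
    simp only [hΛ]
    push_cast
    ring
  simp only [hval] at hsum
  have hfin : (∫ t : ℝ, ∑' n, G n t) = ∫ t : ℝ, (x : ℂ) ^ ((2 : ℝ) + t * Complex.I : ℂ) *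
      LSeries Λ ((2 : ℝ) + t * Complex.I) * P t := by
    congr 1
    ext t
    simp only [hG, tsum_mul_right, tsum_mul_left, LSeries]
  rw [← hfin, ← hsum.tsum_eq, tsum_mul_left]
  push_cast
  rfl

lemma neg_logDeriv_riemannZeta₁_eq {s : ℂ} (hs : 1 < s.re) :
    -logDeriv riemannZeta₁ s =
      LSeries (fun n ↦ (ArithmeticFunction.vonMangoldt n : ℂ)) s - 1 / (s - 1) := by
  have hs1 : s ≠ 1 := by rintro rfl; simp at hs
  have h1 : s - 1 ≠ 0 := sub_ne_zero.2 hs1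
  have hz := riemannZeta_ne_zero_of_one_lt_re hs
  have h2 := riemannZeta_eq_inv_sub_mul hs1
  have h3 : riemannZeta₁ s ≠ 0 := by
    intro h; rw [h2, h] at hz; simp at hz
  rw [ArithmeticFunction.LSeries_vonMangoldt_eq_deriv_riemannZeta_div hs,
    deriv_riemannZeta_eq_neg_inv_sub_sq_mul_add hs1, h2, logDeriv_apply]
  field_simp
  ring

lemma norm_ofReal_cpow_add_one_sub_le {x : ℝ} (hx : 0 < x) {s : ℂ} (hs : 0 ≤ s.re) :
    ‖((x + 1 : ℝ) : ℂ) ^ (s + 1) - (x : ℂ) ^ (s + 1)‖ ≤ ‖s + 1‖ * (x + 1) ^ s.re := by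
  have h1 : s + 1 ≠ 0 := by
    intro h; have := congrArg Complex.re h; simp at this; linarith
  have hd : ∀ u ∈ Set.Icc x (x + 1), HasDerivWithinAt (fun u : ℝ ↦ (u : ℂ) ^ (s + 1))
      ((s + 1) * (u : ℂ) ^ s) (Set.Icc x (x + 1)) u := by
    intro u hu
    have hu0 : u ≠ 0 := (hx.trans_le hu.1).ne'
    simpa using (hasDerivAt_ofReal_cpow_const hu0 h1).hasDerivWithinAt (s := Set.Icc x (x + 1))
  have := (convex_Icc x (x + 1)).norm_image_sub_le_of_norm_hasDerivWithin_le
    (C := ‖s + 1‖ * (x + 1) ^ s.re) hd (fun u hu ↦ ?_) (Set.left_mem_Icc.2 (by linarith))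
    (Set.right_mem_Icc.2 (by linarith))
  · simpa using this
  · have hu0 : 0 < u := hx.trans_le hu.1
    rw [norm_mul, Complex.norm_cpow_eq_rpow_re_of_pos hu0]
    gcongr
    exact hu.2

lemma norm_ofReal_cpow_add_one_sub_le_two_mul {x : ℝ} (hx : 0 < x) {s : ℂ} (hs : 0 ≤ s.re) :
    ‖((x + 1 : ℝ) : ℂ) ^ (s + 1) - (x : ℂ) ^ (s + 1)‖ ≤ 2 * (x + 1) ^ (s.re + 1) := by
  refine (norm_sub_le _ _).trans ?_
  rw [Complex.norm_cpow_eq_rpow_re_of_pos hx, Complex.norm_cpow_eq_rpow_re_of_pos (by linarith)]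
  have : x ^ (s + 1).re ≤ (x + 1) ^ (s + 1).re := by
    gcongr
    · simp; linarith
    · linarith
  simp only [Complex.add_re, Complex.one_re] at this ⊢
  linarith

lemma norm_ofReal_cpow_add_one_sub_div_le {x : ℝ} (hx : 0 < x) {s : ℂ} (hs : 1 / 2 ≤ s.re)
    {ε : ℝ} (hε : 0 ≤ ε) (hε1 : ε ≤ 1) :
    ‖(((x + 1 : ℝ) : ℂ) ^ (s + 1) - (x : ℂ) ^ (s + 1)) * (1 / (s * (s + 1)))‖ ≤
      18 * (x + 1) ^ (s.re + ε) * (1 + |s.im|) ^ (-(1 + ε)) := by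
  set N : ℝ := ‖((x + 1 : ℝ) : ℂ) ^ (s + 1) - (x : ℂ) ^ (s + 1)‖ with hN
  have hX : 0 < x + 1 := by linarith
  have hT : 0 < 1 + |s.im| := by positivity
  have h1 := one_add_abs_im_le hs
  have h2 := one_add_abs_im_le (s := s + 1) (by simp; linarith)
  simp only [Complex.add_im, Complex.one_im, add_zero] at h2
  have hs0 : 0 < ‖s‖ := by linarith
  have hs1 : 0 < ‖s + 1‖ := by linarith
  have hN0 : 0 ≤ N := norm_nonneg _
  have hNle : N ≤ 2 * ‖s + 1‖ ^ (1 - ε) * (x + 1) ^ (s.re + ε) := by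
    calc N = N ^ (1 - ε) * N ^ ε := by
          rw [← Real.rpow_add_of_nonneg hN0 (by linarith) hε]; simp
      _ ≤ (‖s + 1‖ * (x + 1) ^ s.re) ^ (1 - ε) * (2 * (x + 1) ^ (s.re + 1)) ^ ε := by
          gcongr
          · exact norm_ofReal_cpow_add_one_sub_le hx (by linarith)
          · exact norm_ofReal_cpow_add_one_sub_le_two_mul hx (by linarith)
      _ = 2 ^ ε * ‖s + 1‖ ^ (1 - ε) * (x + 1) ^ (s.re + ε) := by
          rw [Real.mul_rpow hs1.le (by positivity), Real.mul_rpow (by norm_num) (by positivity),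
            ← Real.rpow_mul hX.le, ← Real.rpow_mul hX.le]
          have : s.re + ε = s.re * (1 - ε) + (s.re + 1) * ε := by ring
          rw [this, Real.rpow_add hX]
          ring
      _ ≤ 2 * ‖s + 1‖ ^ (1 - ε) * (x + 1) ^ (s.re + ε) := by
          gcongr
          simpa using Real.rpow_le_rpow_of_exponent_le one_le_two hε1
  have hsp : ‖s + 1‖ ^ (1 - ε) = ‖s + 1‖ / ‖s + 1‖ ^ ε := by
    rw [Real.rpow_sub hs1, Real.rpow_one]
  have h3 : (1 + |s.im|) ^ ε ≤ 3 * ‖s + 1‖ ^ ε := by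
    calc (1 + |s.im|) ^ ε ≤ (3 * ‖s + 1‖) ^ ε := by gcongr
      _ = 3 ^ ε * ‖s + 1‖ ^ ε := Real.mul_rpow (by norm_num) hs1.le
      _ ≤ 3 * ‖s + 1‖ ^ ε := by
          gcongr
          simpa using Real.rpow_le_rpow_of_exponent_le (by norm_num : (1 : ℝ) ≤ 3) hε1
  have hrp : (1 + |s.im|) ^ (-(1 + ε)) = 1 / ((1 + |s.im|) * (1 + |s.im|) ^ ε) := by
    rw [Real.rpow_neg hT.le, Real.rpow_add hT, Real.rpow_one, one_div]
  rw [norm_mul, norm_div, norm_mul, norm_one, ← hN, hrp, mul_one_div, mul_one_div,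
    div_le_div_iff₀ (by positivity) (by positivity)]
  have hprod : (1 + |s.im|) * (1 + |s.im|) ^ ε ≤ 9 * (‖s‖ * ‖s + 1‖ ^ ε) := by
    calc (1 + |s.im|) * (1 + |s.im|) ^ ε ≤ (3 * ‖s‖) * (3 * ‖s + 1‖ ^ ε) := by gcongr
      _ = _ := by ring
  calc N * ((1 + |s.im|) * (1 + |s.im|) ^ ε)
      ≤ (2 * ‖s + 1‖ ^ (1 - ε) * (x + 1) ^ (s.re + ε)) * (9 * (‖s‖ * ‖s + 1‖ ^ ε)) := by gcongr
    _ = 18 * (x + 1) ^ (s.re + ε) * (‖s‖ * ‖s + 1‖) := by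
        rw [hsp]
        have : ‖s + 1‖ ^ ε ≠ 0 := by positivity
        field_simp
        ring

lemma exists_norm_logDeriv_mul_le (hRH : RiemannHypothesis') {σ ε : ℝ} (hσ : 1 / 2 < σ)
    (hσ2 : σ < 2) (hε : 0 < ε) (hε1 : ε ≤ 1) :
    ∃ C : ℝ, 0 < C ∧ ∀ x : ℝ, 0 < x → ∀ s : ℂ, σ ≤ s.re → s.re ≤ 2 →
      ‖-logDeriv riemannZeta₁ s *
        ((((x + 1 : ℝ) : ℂ) ^ (s + 1) - (x : ℂ) ^ (s + 1)) * (1 / (s * (s + 1))))‖ ≤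
      C * (x + 1) ^ (s.re + ε) * (1 + |s.im|) ^ (-(1 + ε / 2)) := by
  obtain ⟨C, hC, h⟩ := exists_norm_logDeriv_riemannZeta₁_le hRH hσ hσ2 (half_pos hε)
  refine ⟨C * 5 * 18, by positivity, fun x hx s hs hs2 ↦ ?_⟩
  have hT : 0 < 1 + |s.im| := by positivity
  have h5 : (|s.im| + 5) ^ (ε / 2) ≤ 5 * (1 + |s.im|) ^ (ε / 2) := by
    calc (|s.im| + 5) ^ (ε / 2) ≤ (5 * (1 + |s.im|)) ^ (ε / 2) := by
          gcongr; linarith [abs_nonneg s.im]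
      _ = 5 ^ (ε / 2) * (1 + |s.im|) ^ (ε / 2) := Real.mul_rpow (by norm_num) hT.le
      _ ≤ 5 * (1 + |s.im|) ^ (ε / 2) := by
          gcongr
          simpa using Real.rpow_le_rpow_of_exponent_le (by norm_num : (1 : ℝ) ≤ 5)
            (by linarith : ε / 2 ≤ 1)
  rw [norm_mul, norm_neg]
  calc _ ≤ (C * (5 * (1 + |s.im|) ^ (ε / 2))) *
        (18 * (x + 1) ^ (s.re + ε) * (1 + |s.im|) ^ (-(1 + ε))) := by
        gcongr
        · exact (h s hs hs2).trans (by gcongr)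
        · exact norm_ofReal_cpow_add_one_sub_div_le hx (by linarith) hε.le hε1
    _ = C * 5 * 18 * (x + 1) ^ (s.re + ε) * ((1 + |s.im|) ^ (ε / 2) *
          (1 + |s.im|) ^ (-(1 + ε))) := by ring
    _ = _ := by
        rw [← Real.rpow_add hT]
        congr 2
        ring

lemma differentiableAt_logDeriv_riemannZeta₁ (hRH : RiemannHypothesis') {s : ℂ}
    (hs : 1 / 2 < s.re) : DifferentiableAt ℂ (logDeriv riemannZeta₁) s :=
  (differentiable_riemannZeta₁.deriv s).div (differentiable_riemannZeta₁ s)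
    (riemannZeta₁_ne_zero hRH hs)

lemma differentiableAt_one_div_mul_add_one {s : ℂ} (hs : 0 < s.re) :
    DifferentiableAt ℂ (fun s : ℂ ↦ 1 / (s * (s + 1))) s := by
  refine (differentiableAt_const _).div (by fun_prop) (mul_ne_zero ?_ ?_) <;> intro h <;>
    have := congrArg Complex.re h <;> simp at this <;> linarith

/-- `Σ_{n ≤ x} Λ(n) (x - n)`, the integral of the Chebyshev function `ψ` over `[0, x]`. -/
noncomputable def integralPsi (x : ℝ) : ℝ :=
  ∑' n : ℕ, ArithmeticFunction.vonMangoldt n * max 0 (x - n)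

lemma integrable_logDeriv_riemannZeta₁_mul (hRH : RiemannHypothesis') {x : ℝ} (hx : 0 < x) :
    MeasureTheory.Integrable fun t : ℝ ↦ -logDeriv riemannZeta₁ ((2 : ℝ) + t * Complex.I) *
      ((x : ℂ) ^ ((2 : ℝ) + t * Complex.I + 1 : ℂ) *
      (1 / (((2 : ℝ) + t * Complex.I : ℂ) * (((2 : ℝ) + t * Complex.I : ℂ) + 1)))) := by
  obtain ⟨C, hC, h⟩ := exists_norm_logDeriv_riemannZeta₁_le hRH (σ := 1) (ε := 1 / 2)
    (by norm_num) (by norm_num) (by norm_num)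
  have hx' : (x : ℂ) ≠ 0 := by exact_mod_cast hx.ne'
  refine integrable_of_norm_le_one_add_abs_rpow (M := C * 5 * x ^ (3 : ℝ) * 9) (r := 3 / 2) ?_
    (by norm_num) fun t ↦ ?_
  · refine Continuous.mul ?_ (Continuous.mul ?_ (continuous_one_div_mul_add_one (by norm_num)))
    · refine Continuous.neg (continuous_iff_continuousAt.2 fun t ↦ ?_)
      exact ContinuousAt.comp (g := logDeriv riemannZeta₁)
        (f := fun t : ℝ ↦ ((2 : ℝ) + t * Complex.I : ℂ))
        (differentiableAt_logDeriv_riemannZeta₁ hRH (by simp; norm_num)).continuousAt (by fun_prop)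
    · exact Continuous.const_cpow (by fun_prop) (Or.inl hx')
  · have hT : 0 < 1 + |t| := by positivity
    have h1 := h ((2 : ℝ) + t * Complex.I) (by simp) (by simp)
    have h2 := norm_one_div_mul_add_one_le (s := (2 : ℝ) + t * Complex.I) (by simp; norm_num)
    have h3 : (|t| + 5) ^ (1 / 2 : ℝ) ≤ 5 * (1 + |t|) ^ (1 / 2 : ℝ) := by
      calc (|t| + 5) ^ (1 / 2 : ℝ) ≤ (5 * (1 + |t|)) ^ (1 / 2 : ℝ) := by
            gcongr; linarith [abs_nonneg t]
        _ = 5 ^ (1 / 2 : ℝ) * (1 + |t|) ^ (1 / 2 : ℝ) := Real.mul_rpow (by norm_num) hT.le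
        _ ≤ 5 * (1 + |t|) ^ (1 / 2 : ℝ) := by
            gcongr
            simpa using Real.rpow_le_rpow_of_exponent_le (by norm_num : (1 : ℝ) ≤ 5)
              (by norm_num : (1 / 2 : ℝ) ≤ 1)
    simp only [Complex.add_im, Complex.ofReal_im, Complex.mul_im, Complex.ofReal_re, Complex.I_im,
      mul_one, Complex.I_re, mul_zero, add_zero, zero_add] at h1 h2
    rw [norm_mul, norm_mul, norm_neg, Complex.norm_cpow_eq_rpow_re_of_pos hx]
    have h4 : ((2 : ℝ) + t * Complex.I + 1 : ℂ).re = 3 := by simp; norm_num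
    rw [h4]
    calc _ ≤ (C * (5 * (1 + |t|) ^ (1 / 2 : ℝ))) * (x ^ (3 : ℝ) * (9 * (1 + |t|) ^ (-2 : ℝ))) := by
          gcongr
          exact h1.trans (by gcongr)
      _ = C * 5 * x ^ (3 : ℝ) * 9 * ((1 + |t|) ^ (1 / 2 : ℝ) * (1 + |t|) ^ (-2 : ℝ)) := by ring
      _ = _ := by
          rw [← Real.rpow_add hT]
          norm_num

lemma integral_logDeriv_riemannZeta₁_mul (hRH : RiemannHypothesis') {x : ℝ} (hx : 1 ≤ x) :
    ∫ t : ℝ, -logDeriv riemannZeta₁ ((2 : ℝ) + t * Complex.I) *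
      ((x : ℂ) ^ ((2 : ℝ) + t * Complex.I + 1 : ℂ) *
      (1 / (((2 : ℝ) + t * Complex.I : ℂ) * (((2 : ℝ) + t * Complex.I : ℂ) + 1)))) =
    2 * Real.pi * ((integralPsi x - (x - 1) ^ 2 / 2 : ℝ) : ℂ) := by
  have hx0 : 0 < x := by linarith
  have hx' : (x : ℂ) ≠ 0 := by exact_mod_cast hx0.ne'
  have hi := integrable_logDeriv_riemannZeta₁_mul hRH hx0
  have hΛ := integral_cpow_mul_LSeries_vonMangoldt hx0
  have hmi : MeasureTheory.Integrable fun t : ℝ ↦ 1 / (((2 : ℝ) + t * Complex.I - 1 : ℂ) *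
      (((2 : ℝ) + t * Complex.I : ℂ) * (((2 : ℝ) + t * Complex.I : ℂ) + 1))) := by
    refine (integrable_one_div_mul_add_one (σ := 2) (by norm_num)).norm.mono' ?_
      (.of_forall fun t ↦ ?_)
    · refine Continuous.aestronglyMeasurable (continuous_const.div (by fun_prop) fun t ↦ ?_)
      refine mul_ne_zero ?_ (mul_ne_zero ?_ ?_) <;> intro h <;>
        have := congrArg Complex.re h <;> simp at this <;> norm_num at this
    · have h1 : 1 ≤ ‖((2 : ℝ) + t * Complex.I - 1 : ℂ)‖ := by
        refine le_trans ?_ (Complex.abs_re_le_norm _)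
        simp; norm_num
      rw [one_div, mul_inv, norm_mul, norm_inv, one_div]
      exact mul_le_of_le_one_left (norm_nonneg _) (inv_le_one_of_one_le₀ h1)
  have hk := integral_cpow_mul_eq_of_hasMellin (σ := 2) hx0
    (fun t ↦ hasMellin_max_one_sub_sq_div (s := (2 : ℝ) + t * Complex.I) (by simp))
    (m := fun s ↦ 1 / ((s - 1) * (s * (s + 1)))) hmi (by
      have : (2 : ℝ) * x⁻¹ ≠ 0 := by positivity
      fun_prop (disch := assumption))
  have hki : MeasureTheory.Integrable fun t : ℝ ↦ (x : ℂ) ^ ((2 : ℝ) + t * Complex.I : ℂ) *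
      (1 / (((2 : ℝ) + t * Complex.I - 1 : ℂ) *
      (((2 : ℝ) + t * Complex.I : ℂ) * (((2 : ℝ) + t * Complex.I : ℂ) + 1)))) := by
    refine hmi.bdd_mul (c := x ^ (2 : ℝ)) ?_ (.of_forall fun t ↦ ?_)
    · exact (Continuous.const_cpow (by fun_prop) (Or.inl hx')).aestronglyMeasurable
    · rw [Complex.norm_cpow_eq_rpow_re_of_pos hx0]; simp
  have hsplit : ∀ t : ℝ, (x : ℂ) ^ ((2 : ℝ) + t * Complex.I : ℂ) *
      LSeries (fun n ↦ (ArithmeticFunction.vonMangoldt n : ℂ)) ((2 : ℝ) + t * Complex.I) *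
      (1 / (((2 : ℝ) + t * Complex.I : ℂ) * (((2 : ℝ) + t * Complex.I : ℂ) + 1))) =
      (x : ℂ)⁻¹ * (-logDeriv riemannZeta₁ ((2 : ℝ) + t * Complex.I) *
      ((x : ℂ) ^ ((2 : ℝ) + t * Complex.I + 1 : ℂ) *
      (1 / (((2 : ℝ) + t * Complex.I : ℂ) * (((2 : ℝ) + t * Complex.I : ℂ) + 1))))) +
      (x : ℂ) ^ ((2 : ℝ) + t * Complex.I : ℂ) * (1 / (((2 : ℝ) + t * Complex.I - 1 : ℂ) *
      (((2 : ℝ) + t * Complex.I : ℂ) * (((2 : ℝ) + t * Complex.I : ℂ) + 1)))) := by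
    intro t
    rw [neg_logDeriv_riemannZeta₁_eq (by simp),
      Complex.cpow_add ((2 : ℝ) + t * Complex.I) 1 hx', Complex.cpow_one,
      one_div (((2 : ℝ) + t * Complex.I - 1 : ℂ) * _), mul_inv]
    field_simp
    ring
  simp only [hsplit] at hΛ
  rw [MeasureTheory.integral_add (hi.const_mul _) hki, MeasureTheory.integral_const_mul, hk] at hΛ
  have hmax : max 0 (1 - x⁻¹) = 1 - x⁻¹ := max_eq_right (sub_nonneg.2 (inv_le_one_of_one_le₀ hx))
  have hpsi : x * ∑' n : ℕ, ArithmeticFunction.vonMangoldt n * max 0 (1 - n / x) =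
      integralPsi x := by
    rw [integralPsi, ← tsum_mul_left]
    congr 1
    ext n
    rw [mul_left_comm, mul_max_of_nonneg _ _ hx0.le, mul_zero, mul_sub, mul_one,
      mul_div_cancel₀ _ hx0.ne']
  rw [(inv_mul_eq_iff_eq_mul₀ hx').1 (eq_sub_of_add_eq hΛ), ← hpsi, hmax]
  push_cast
  field_simp

lemma exists_abs_integralPsi_add_one_sub_le (hRH : RiemannHypothesis') {σ ε : ℝ}
    (hσ : 1 / 2 < σ) (hσ2 : σ < 2) (hε : 0 < ε) (hε1 : ε ≤ 1) :
    ∃ C : ℝ, 0 < C ∧ ∀ x : ℝ, 1 ≤ x →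
      |integralPsi (x + 1) - integralPsi x - (x - 1 / 2)| ≤ C * (x + 1) ^ (σ + ε) := by
  obtain ⟨C, hC, hb⟩ := exists_norm_logDeriv_mul_le hRH hσ hσ2 hε hε1
  set A : ℝ := ∫ t : ℝ, (1 + ‖t‖) ^ (-(1 + ε / 2)) with hA
  have hAi : MeasureTheory.Integrable fun t : ℝ ↦ (1 + ‖t‖) ^ (-(1 + ε / 2)) :=
    integrable_one_add_norm (by simp; linarith)
  have hA0 : 0 ≤ A := MeasureTheory.integral_nonneg fun t ↦ by positivity
  refine ⟨C * A + 1, by positivity, fun x hx ↦ ?_⟩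
  have hx0 : 0 < x := by linarith
  have hX : 0 < x + 1 := by linarith
  set H : ℂ → ℂ := fun s ↦ -logDeriv riemannZeta₁ s *
    ((((x + 1 : ℝ) : ℂ) ^ (s + 1) - (x : ℂ) ^ (s + 1)) * (1 / (s * (s + 1)))) with hH
  have hshift : ∫ t : ℝ, H (σ + t * Complex.I) = ∫ t : ℝ, H ((2 : ℝ) + t * Complex.I) := by
    refine integral_vertical_eq_of_norm_le hσ2.le (M := C * (x + 1) ^ (2 + ε)) (r := 1 + ε / 2)
      (by linarith) (fun s h1 h2 ↦ ?_) fun s h1 h2 ↦ ?_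
    · refine (differentiableAt_logDeriv_riemannZeta₁ hRH (by linarith)).neg.mul
        (DifferentiableAt.mul (DifferentiableAt.sub ?_ ?_)
          (differentiableAt_one_div_mul_add_one (by linarith)))
      · exact DifferentiableAt.const_cpow (by fun_prop) (Or.inl (by exact_mod_cast hX.ne'))
      · exact DifferentiableAt.const_cpow (by fun_prop) (Or.inl (by exact_mod_cast hx0.ne'))
    · refine (hb x hx0 s h1 h2).trans ?_
      gcongr
      linarith
  have hval : ∫ t : ℝ, H ((2 : ℝ) + t * Complex.I) =
      2 * Real.pi * ((integralPsi (x + 1) - integralPsi x - (x - 1 / 2) : ℝ) : ℂ) := by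
    have h1 := integral_logDeriv_riemannZeta₁_mul hRH hx
    have h2 := integral_logDeriv_riemannZeta₁_mul hRH (x := x + 1) (by linarith)
    have h3 := MeasureTheory.integral_sub (integrable_logDeriv_riemannZeta₁_mul hRH hX)
      (integrable_logDeriv_riemannZeta₁_mul hRH hx0)
    rw [h1, h2] at h3
    have h4 : ∀ t : ℝ, H ((2 : ℝ) + t * Complex.I) =
      (-logDeriv riemannZeta₁ ((2 : ℝ) + t * Complex.I) *
      (((x + 1 : ℝ) : ℂ) ^ ((2 : ℝ) + t * Complex.I + 1 : ℂ) *
      (1 / (((2 : ℝ) + t * Complex.I : ℂ) * (((2 : ℝ) + t * Complex.I : ℂ) + 1))))) -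
      (-logDeriv riemannZeta₁ ((2 : ℝ) + t * Complex.I) *
      ((x : ℂ) ^ ((2 : ℝ) + t * Complex.I + 1 : ℂ) *
      (1 / (((2 : ℝ) + t * Complex.I : ℂ) * (((2 : ℝ) + t * Complex.I : ℂ) + 1))))) := by
      intro t
      simp only [hH]
      ring
    simp only [h4]
    rw [h3]
    push_cast
    ring
  have hle : ‖∫ t : ℝ, H (σ + t * Complex.I)‖ ≤ C * (x + 1) ^ (σ + ε) * A := by
    rw [hA, ← MeasureTheory.integral_const_mul]
    refine MeasureTheory.norm_integral_le_of_norm_le (hAi.const_mul _) (.of_forall fun t ↦ ?_)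
    have h1 := hb x hx0 (σ + t * Complex.I) (by simp) (by simpa using hσ2.le)
    have h2 : (σ + t * Complex.I : ℂ).re = σ := by simp
    have h3 : (σ + t * Complex.I : ℂ).im = t := by simp
    rwa [h2, h3] at h1
  rw [hshift, hval, norm_mul, Complex.norm_real, Real.norm_eq_abs] at hle
  have h2pi : ‖(2 * Real.pi : ℂ)‖ = 2 * Real.pi := by
    simp [abs_of_pos Real.pi_pos]
  rw [h2pi] at hle
  have hpi := Real.pi_gt_three
  have hpos : 0 < (x + 1) ^ (σ + ε) := by positivity
  have habs := abs_nonneg (integralPsi (x + 1) - integralPsi x - (x - 1 / 2))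
  nlinarith

lemma integralPsi_eq_sum {x : ℝ} {M : ℕ} (hM : x ≤ M) :
    integralPsi x = ∑ n ∈ Ioc 0 M, ArithmeticFunction.vonMangoldt n * max 0 (x - n) := by
  refine tsum_eq_sum fun n hn ↦ ?_
  rcases Nat.eq_zero_or_pos n with rfl | h
  · simp
  have h1 : M < n := by simpa [h] using hn
  have h2 : (M : ℝ) < n := by exact_mod_cast h1
  rw [max_eq_left (by linarith), mul_zero]

lemma integralPsi_add_one_sub_eq_sum {x : ℝ} {M : ℕ} (hM : x + 1 ≤ M) :
    integralPsi (x + 1) - integralPsi x = ∑ n ∈ Ioc 0 M,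
      ArithmeticFunction.vonMangoldt n * (max 0 (x + 1 - n) - max 0 (x - n)) := by
  rw [integralPsi_eq_sum hM, integralPsi_eq_sum (by linarith : x ≤ M), ← sum_sub_distrib]
  simp only [mul_sub]

lemma psi_le_integralPsi_add_one_sub {x : ℝ} (hx : 0 ≤ x) :
    Chebyshev.psi x ≤ integralPsi (x + 1) - integralPsi x := by
  rw [integralPsi_add_one_sub_eq_sum (Nat.le_ceil (x + 1)), Chebyshev.psi]
  calc ∑ n ∈ Ioc 0 ⌊x⌋₊, ArithmeticFunction.vonMangoldt n
      ≤ ∑ n ∈ Ioc 0 ⌊x⌋₊,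
        ArithmeticFunction.vonMangoldt n * (max 0 (x + 1 - n) - max 0 (x - n)) := by
        refine sum_le_sum fun n hn ↦ ?_
        have h1 : (n : ℝ) ≤ x := (Nat.le_floor_iff hx).1 (mem_Ioc.1 hn).2
        rw [max_eq_right (by linarith), max_eq_right (by linarith)]
        apply le_of_eq
        ring
    _ ≤ _ := by
        refine sum_le_sum_of_subset_of_nonneg (Ioc_subset_Ioc_right ?_) fun n _ _ ↦ ?_
        · exact (Nat.floor_le_ceil x).trans (Nat.ceil_mono (by linarith))
        · refine mul_nonneg ArithmeticFunction.vonMangoldt_nonneg (sub_nonneg.2 ?_)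
          exact max_le_max le_rfl (by linarith)

lemma integralPsi_add_one_sub_le_psi {x : ℝ} (hx : 0 ≤ x) :
    integralPsi (x + 1) - integralPsi x ≤ Chebyshev.psi (x + 1) := by
  rw [integralPsi_add_one_sub_eq_sum (Nat.le_ceil (x + 1)), Chebyshev.psi]
  have hsub : Ioc 0 ⌊x + 1⌋₊ ⊆ Ioc 0 ⌈x + 1⌉₊ := Ioc_subset_Ioc_right (Nat.floor_le_ceil _)
  rw [← sum_subset hsub fun n hn hn' ↦ ?_]
  · refine sum_le_sum fun n hn ↦ ?_
    refine mul_le_of_le_one_right ArithmeticFunction.vonMangoldt_nonneg ?_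
    rw [sub_le_iff_le_add]
    refine max_le (by positivity) ?_
    linarith [le_max_right 0 (x - n)]
  · have h1 : ⌊x + 1⌋₊ < n := by
      by_contra h
      exact hn' (mem_Ioc.2 ⟨(mem_Ioc.1 hn).1, not_lt.1 h⟩)
    have h2 : x + 1 < n := (Nat.floor_lt (by linarith)).1 h1
    rw [max_eq_left (by linarith), max_eq_left (by linarith)]
    simp

lemma exists_abs_psi_sub_le (hRH : RiemannHypothesis') {α : ℝ} (hα : 1 / 2 < α) (hα1 : α < 1) :
    ∃ C : ℝ, 0 < C ∧ ∀ x : ℝ, 2 ≤ x → |Chebyshev.psi x - x| ≤ C * x ^ α := by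
  obtain ⟨C, hC, h⟩ := exists_abs_integralPsi_add_one_sub_le hRH (σ := (α + 1 / 2) / 2)
    (ε := (α - 1 / 2) / 2) (by linarith) (by linarith) (by linarith) (by linarith)
  have hexp : (α + 1 / 2) / 2 + (α - 1 / 2) / 2 = α := by ring
  rw [hexp] at h
  refine ⟨2 * C + 3 / 2, by positivity, fun x hx ↦ ?_⟩
  have hx0 : 0 < x := by linarith
  have h1 : 1 ≤ x ^ α := Real.one_le_rpow (by linarith) (by linarith)
  have h2 : (x + 1) ^ α ≤ 2 * x ^ α := by
    calc (x + 1) ^ α ≤ (2 * x) ^ α := by gcongr; linarith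
      _ = 2 ^ α * x ^ α := Real.mul_rpow (by norm_num) hx0.le
      _ ≤ 2 * x ^ α := by
          gcongr
          simpa using Real.rpow_le_rpow_of_exponent_le one_le_two hα1.le
  have hu := (abs_le.1 (h x (by linarith))).2
  have hl := (abs_le.1 (h (x - 1) (by linarith))).1
  have hpu := psi_le_integralPsi_add_one_sub hx0.le
  have hpl := integralPsi_add_one_sub_le_psi (x := x - 1) (by linarith)
  simp only [sub_add_cancel] at hl hpl
  have h3 : C * (x + 1) ^ α ≤ C * (2 * x ^ α) := by gcongr
  have h4 : 0 < C * x ^ α := by positivity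
  rw [abs_le]
  constructor <;> nlinarith

lemma exists_abs_theta_sub_le (hRH : RiemannHypothesis') {α : ℝ} (hα : 1 / 2 < α) (hα1 : α < 1) :
    ∃ C : ℝ, 0 < C ∧ ∀ x : ℝ, 2 ≤ x → |Chebyshev.theta x - x| ≤ C * x ^ α := by
  obtain ⟨C, hC, h⟩ := exists_abs_psi_sub_le hRH hα hα1
  obtain ⟨D, hD⟩ := Chebyshev.psi_sub_theta_le_mul_sqrt
  refine ⟨C + |D|, by positivity, fun x hx ↦ ?_⟩
  have h1 := abs_le.1 (h x hx)
  have h2 := Chebyshev.theta_le_psi x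
  have h3 : D * √x ≤ |D| * x ^ α := by
    gcongr
    · exact le_abs_self D
    · rw [Real.sqrt_eq_rpow]
      exact Real.rpow_le_rpow_of_exponent_le (by linarith) hα.le
  have h4 : 0 ≤ |D| * x ^ α := by positivity
  rw [abs_le]
  constructor <;> linarith [hD x, h1.1, h1.2]

/-- The primes in the interval `[X, X + X ^ δ]`. -/
noncomputable def shortIntervalPrimes (X δ : ℝ) : Finset ℕ :=
  (Finset.range (Nat.floor (X + X ^ δ) + 1)).filter
    (fun N : ℕ => N.Prime ∧ X ≤ (N : ℝ) ∧ (N : ℝ) ≤ X + X ^ δ)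

lemma mem_shortIntervalPrimes {X δ : ℝ} {N : ℕ} :
    N ∈ shortIntervalPrimes X δ ↔ N.Prime ∧ X ≤ (N : ℝ) ∧ (N : ℝ) ≤ X + X ^ δ := by
  rw [shortIntervalPrimes, mem_filter, mem_range, and_iff_right_iff_imp]
  exact fun h ↦ Nat.lt_succ_of_le (Nat.le_floor h.2.2)

lemma theta_sub_le_sum_log_shortIntervalPrimes {X δ : ℝ} (hX : 0 ≤ X) :
    Chebyshev.theta (X + X ^ δ) - Chebyshev.theta X ≤
      ∑ p ∈ shortIntervalPrimes X δ, Real.log p := by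
  have hpow : 0 ≤ X ^ δ := by positivity
  rw [sub_le_iff_le_add, Chebyshev.theta, Chebyshev.theta, ← sum_union_inter]
  refine le_add_of_le_of_nonneg (sum_le_sum_of_subset_of_nonneg (fun p hp ↦ ?_) fun p _ _ ↦ ?_)
    (sum_nonneg fun p _ ↦ Real.log_natCast_nonneg p)
  · rw [mem_filter, mem_Ioc, Nat.le_floor_iff (by positivity)] at hp
    rw [mem_union, mem_shortIntervalPrimes, mem_filter, mem_Ioc, Nat.le_floor_iff hX]
    rcases le_total X p with h | h
    · exact Or.inl ⟨hp.2, h, hp.1.2⟩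
    · exact Or.inr ⟨⟨hp.1.1, h⟩, hp.2⟩
  · exact Real.log_natCast_nonneg p

lemma sum_log_shortIntervalPrimes_le {X δ : ℝ} (hX : 1 ≤ X) :
    ∑ p ∈ shortIntervalPrimes X δ, Real.log p ≤
      Chebyshev.theta (X + X ^ δ) - Chebyshev.theta (X - 1) := by
  have hpow : 0 ≤ X ^ δ := by positivity
  rw [le_sub_iff_add_le, Chebyshev.theta, Chebyshev.theta, ← sum_union]
  · refine sum_le_sum_of_subset_of_nonneg (fun p hp ↦ ?_) fun p _ _ ↦ Real.log_natCast_nonneg p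
    rw [mem_union, mem_shortIntervalPrimes, mem_filter, mem_Ioc,
      Nat.le_floor_iff (by linarith)] at hp
    rw [mem_filter, mem_Ioc, Nat.le_floor_iff (by linarith)]
    rcases hp with h | h
    · exact ⟨⟨h.1.pos, h.2.2⟩, h.1⟩
    · exact ⟨⟨h.1.1, by linarith [h.1.2]⟩, h.2⟩
  · rw [disjoint_left]
    intro p h1 h2
    rw [mem_shortIntervalPrimes] at h1
    rw [mem_filter, mem_Ioc, Nat.le_floor_iff (by linarith)] at h2
    linarith [h1.2.1, h2.1.2]

lemma tendsto_sum_log_shortIntervalPrimes_div (hRH : RiemannHypothesis') {δ : ℝ}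
    (hδ : 1 / 2 < δ) (hδ1 : δ < 1) :
    Tendsto (fun X : ℝ ↦ (∑ p ∈ shortIntervalPrimes X δ, Real.log p) / X ^ δ) atTop (𝓝 1) := by
  set α : ℝ := (δ + 1 / 2) / 2 with hα
  obtain ⟨C, hC, h⟩ := exists_abs_theta_sub_le hRH (α := α) (by linarith) (by linarith)
  have hlim : Tendsto (fun X : ℝ ↦ (3 * C + 1) * X ^ (-(δ - α))) atTop (𝓝 0) := by
    simpa using (tendsto_rpow_neg_atTop (by linarith : 0 < δ - α)).const_mul (3 * C + 1)
  rw [tendsto_iff_dist_tendsto_zero]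
  refine squeeze_zero' (.of_forall fun _ ↦ dist_nonneg) ?_ hlim
  filter_upwards [eventually_ge_atTop 3] with X hX
  have hX0 : 0 < X := by linarith
  have hpow : 0 < X ^ δ := by positivity
  have hle : X ^ δ ≤ X := by
    simpa using Real.rpow_le_rpow_of_exponent_le (by linarith : 1 ≤ X) hδ1.le
  have hone : 1 ≤ X ^ α := Real.one_le_rpow (by linarith) (by linarith)
  have h1 := abs_le.1 (h (X + X ^ δ) (by linarith))
  have h2 := abs_le.1 (h X (by linarith))
  have h3 := abs_le.1 (h (X - 1) (by linarith))
  have h4 : (X + X ^ δ) ^ α ≤ 2 * X ^ α := by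
    calc (X + X ^ δ) ^ α ≤ (2 * X) ^ α := by gcongr; linarith
      _ = 2 ^ α * X ^ α := Real.mul_rpow (by norm_num) hX0.le
      _ ≤ 2 * X ^ α := by
          gcongr
          simpa using Real.rpow_le_rpow_of_exponent_le one_le_two (by linarith : α ≤ 1)
  have h5 : (X - 1) ^ α ≤ X ^ α := by
    gcongr
    · linarith
    · linarith
  have h6 : C * (X + X ^ δ) ^ α ≤ C * (2 * X ^ α) := by gcongr
  have h7 : C * (X - 1) ^ α ≤ C * X ^ α := by gcongr
  have hl := theta_sub_le_sum_log_shortIntervalPrimes (δ := δ) hX0.le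
  have hu := sum_log_shortIntervalPrimes_le (X := X) (δ := δ) (by linarith)
  have hsplit : X ^ (-(δ - α)) = X ^ α / X ^ δ := by
    rw [neg_sub, Real.rpow_sub hX0]
  rw [Real.dist_eq, div_sub_one hpow.ne', abs_div, abs_of_pos hpow, hsplit, ← mul_div_assoc]
  gcongr
  rw [abs_le]
  constructor <;> nlinarith [h1.1, h1.2, h2.1, h2.2, h3.1, h3.2]

lemma tendsto_log_div_log_const_mul {c : ℝ} (hc : 0 < c) :
    Tendsto (fun X : ℝ ↦ Real.log X / Real.log (c * X)) atTop (𝓝 1) := by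
  have h1 : Tendsto (fun X : ℝ ↦ Real.log c / Real.log X) atTop (𝓝 0) :=
    tendsto_const_nhds.div_atTop Real.tendsto_log_atTop
  have h2 : Tendsto (fun X : ℝ ↦ (Real.log c / Real.log X + 1)⁻¹) atTop (𝓝 1) := by
    simpa using (h1.add_const 1).inv₀ (by norm_num)
  refine h2.congr' ?_
  filter_upwards [eventually_gt_atTop 1] with X hX
  have := Real.log_pos hX
  rw [Real.log_mul hc.ne' (by linarith), div_add_one this.ne', inv_div]

lemma tendsto_log_div_mul_card_shortIntervalPrimes (hRH : RiemannHypothesis') {δ : ℝ}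
    (hδ : 1 / 2 < δ) (hδ1 : δ < 1) :
    Tendsto (fun X : ℝ ↦ Real.log X / X ^ δ * #(shortIntervalPrimes X δ)) atTop (𝓝 1) := by
  have h1 := tendsto_sum_log_shortIntervalPrimes_div hRH hδ hδ1
  have h2 := (tendsto_log_div_log_const_mul two_pos).mul h1
  rw [one_mul] at h2
  refine tendsto_of_tendsto_of_tendsto_of_le_of_le' h2 h1 ?_ ?_
  · filter_upwards [eventually_gt_atTop 1] with X hX
    have hX0 : 0 < X := by linarith
    have hle : X ^ δ ≤ X := by
      simpa using Real.rpow_le_rpow_of_exponent_le hX.le hδ1.le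
    have hlog := Real.log_pos hX
    have hlog2 : 0 < Real.log (2 * X) := Real.log_pos (by linarith)
    have hsum : ∑ p ∈ shortIntervalPrimes X δ, Real.log p ≤
        #(shortIntervalPrimes X δ) * Real.log (2 * X) := by
      rw [← nsmul_eq_mul]
      refine sum_le_card_nsmul _ _ _ fun p hp ↦ ?_
      rw [mem_shortIntervalPrimes] at hp
      exact Real.log_le_log (by exact_mod_cast hp.1.pos) (by linarith)
    calc _ ≤ Real.log X / Real.log (2 * X) *
          ((#(shortIntervalPrimes X δ) * Real.log (2 * X)) / X ^ δ) := by gcongr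
      _ = _ := by field_simp
  · filter_upwards [eventually_gt_atTop 1] with X hX
    have hX0 : 0 < X := by linarith
    rw [div_mul_eq_mul_div]
    gcongr
    rw [mul_comm, ← nsmul_eq_mul]
    refine card_nsmul_le_sum _ _ _ fun p hp ↦ ?_
    rw [mem_shortIntervalPrimes] at hp
    exact Real.log_le_log hX0 hp.2.1

lemma eventually_nonempty_shortIntervalPrimes (hRH : RiemannHypothesis') {δ : ℝ}
    (hδ : 1 / 2 < δ) (hδ1 : δ < 1) :
    ∀ᶠ X : ℝ in atTop, (shortIntervalPrimes X δ).Nonempty := by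
  filter_upwards [(tendsto_log_div_mul_card_shortIntervalPrimes hRH hδ hδ1).eventually_const_lt
    zero_lt_one] with X hX
  rw [nonempty_iff_ne_empty]
  intro h
  simp [h] at hX

lemma leastPrime_spec (x : ℝ) : (leastPrime x).Prime ∧ x ≤ leastPrime x := by
  have : {p : ℕ | p.Prime ∧ x ≤ (p : ℝ)}.Nonempty := by
    obtain ⟨p, hp, hp'⟩ := Nat.exists_infinite_primes ⌈x⌉₊
    exact ⟨p, hp', (Nat.le_ceil x).trans (by exact_mod_cast hp)⟩
  exact Nat.sInf_mem this

lemma tendsto_leastPrime_div (hRH : RiemannHypothesis') :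
    Tendsto (fun x : ℝ ↦ (leastPrime x : ℝ) / x) atTop (𝓝 1) := by
  have h : Tendsto (fun x : ℝ ↦ 1 + x ^ (-(1 / 4) : ℝ)) atTop (𝓝 1) := by
    simpa using (tendsto_rpow_neg_atTop (by norm_num : (0 : ℝ) < 1 / 4)).const_add 1
  refine tendsto_of_tendsto_of_tendsto_of_le_of_le' tendsto_const_nhds h ?_ ?_
  · filter_upwards [eventually_gt_atTop 0] with x hx
    rw [one_le_div hx]
    exact (leastPrime_spec x).2
  · filter_upwards [eventually_gt_atTop 0, eventually_nonempty_shortIntervalPrimes hRH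
      (δ := 3 / 4) (by norm_num) (by norm_num)] with x hx ⟨p, hp⟩
    rw [mem_shortIntervalPrimes] at hp
    have h1 : leastPrime x ≤ p := Nat.sInf_le ⟨hp.1, hp.2.1⟩
    have h2 : (leastPrime x : ℝ) ≤ p := by exact_mod_cast h1
    rw [div_le_iff₀ hx, add_mul, one_mul]
    have h3 : x ^ (-(1 / 4) : ℝ) * x = x ^ (3 / 4 : ℝ) := by
      rw [← Real.rpow_add_one hx.ne']
      norm_num
    linarith

lemma gaussSum'_eq_gaussSum {N : ℕ} [NeZero N] (χ : DirichletCharacter ℂ N) :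
    gaussSum' χ = gaussSum χ ZMod.stdAddChar := by
  have hN : 0 < N := Nat.pos_of_ne_zero (NeZero.ne N)
  refine sum_bij' (fun b _ ↦ (b : ZMod N)) (fun a _ ↦ if a = 0 then N else a.val)
    (fun _ _ ↦ mem_univ _) (fun a _ ↦ ?_) (fun b hb ↦ ?_) (fun a _ ↦ ?_) fun b _ ↦ ?_
  · rw [mem_Icc]
    split_ifs with h
    · exact ⟨hN, le_rfl⟩
    · exact ⟨ZMod.val_pos.2 h, (ZMod.val_lt a).le⟩
  · rw [mem_Icc] at hb
    simp only [ZMod.natCast_eq_zero_iff]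
    split_ifs with h
    · exact Nat.dvd_antisymm h <| by
        rw [(Nat.le_of_dvd hb.1 h).antisymm hb.2]
    · rw [ZMod.val_natCast, Nat.mod_eq_of_lt]
      exact hb.2.lt_of_ne fun h' ↦ h (h' ▸ dvd_rfl)
  · split_ifs with h
    · simp [h]
    · simp
  · have := ZMod.stdAddChar_coe (N := N) (b : ℤ)
    rw [Int.cast_natCast, Int.cast_natCast] at this
    rw [this]

lemma isPrimitive_iff_ne_one {N : ℕ} (hN : N.Prime) (χ : DirichletCharacter ℂ N) :
    χ.IsPrimitive ↔ χ ≠ 1 := by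
  have : NeZero N := ⟨hN.ne_zero⟩
  rw [DirichletCharacter.isPrimitive_def, Ne, DirichletCharacter.eq_one_iff_conductor_eq_one]
  refine ⟨fun h h1 ↦ hN.one_lt.ne' (h ▸ h1), fun h ↦ ?_⟩
  exact ((Nat.dvd_prime hN).1 χ.conductor_dvd_level).resolve_left h

lemma sum_char_mul_gaussSum_inv {N : ℕ} [Fact N.Prime] (ψ : AddChar (ZMod N) ℂ)
    {a : ZMod N} (ha : a ≠ 0) :
    ∑ χ : DirichletCharacter ℂ N, χ a * gaussSum χ⁻¹ ψ = N.totient * ψ a := by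
  have h (b : ZMod N) : ∑ χ : DirichletCharacter ℂ N, χ a * χ⁻¹ b =
      if a = b then (N.totient : ℂ) else 0 := by
    simp_rw [MulChar.inv_apply', ← map_mul]
    rw [DirichletCharacter.sum_characters_eq]
    congr 1
    rcases eq_or_ne b 0 with rfl | hb
    · simp [ha]
    · rw [mul_inv_eq_one₀ hb]
  simp_rw [gaussSum, mul_sum, ← mul_assoc]
  rw [sum_comm]
  simp_rw [← sum_mul, h]
  simp

lemma inv_gaussSum_stdAddChar {N : ℕ} [Fact N.Prime] {χ : DirichletCharacter ℂ N}
    (hχ : χ ≠ 1) :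
    (gaussSum χ ZMod.stdAddChar)⁻¹ = gaussSum χ⁻¹ (ZMod.stdAddChar)⁻¹ / N := by
  have h := gaussSum_mul_gaussSum_eq_card hχ (ZMod.isPrimitive_stdAddChar N)
  have hN : (N : ℂ) ≠ 0 := by exact_mod_cast (Fact.out : N.Prime).ne_zero
  rw [ZMod.card] at h
  refine inv_eq_of_mul_eq_one_right ?_
  rw [← mul_div_assoc, h, div_self hN]

lemma stdAddChar_inv_add_stdAddChar_inv_neg {N : ℕ} [NeZero N] (p : ℕ) :
    (ZMod.stdAddChar (N := N))⁻¹ p + (ZMod.stdAddChar (N := N))⁻¹ (-p) =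
      2 * (Real.cos (2 * Real.pi * (p / N)) : ℂ) := by
  have h := ZMod.stdAddChar_coe (N := N) (p : ℤ)
  have h' := ZMod.stdAddChar_coe (N := N) (-p : ℤ)
  push_cast at h h'
  rw [AddChar.inv_apply, AddChar.inv_apply, neg_neg, h, h', Complex.ofReal_cos, Complex.two_cos]
  push_cast
  rw [add_comm]
  congr 2 <;> ring

/-- The sum over even primitive characters modulo a prime, evaluated by orthogonality. -/
lemma finsum_even_primitive_eq {N : ℕ} (hN : N.Prime) {p : ℕ} (hp : (p : ZMod N) ≠ 0) :
    ∑ᶠ χ ∈ {χ : DirichletCharacter ℂ N | χ.IsPrimitive ∧ χ (-1) = 1},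
        χ (p : ZMod N) / gaussSum' χ =
      (N - 1) / N * (Real.cos (2 * Real.pi * (p / N)) : ℂ) + 1 / N := by
  have : Fact N.Prime := ⟨hN⟩
  have hN0 : (N : ℂ) ≠ 0 := by exact_mod_cast hN.ne_zero
  set ψ : AddChar (ZMod N) ℂ := (ZMod.stdAddChar)⁻¹ with hψ
  have hψ1 : ψ ≠ 1 := by
    rw [hψ, inv_ne_one]
    intro h
    exact one_ne_zero (ZMod.injective_stdAddChar (N := N) (a₁ := 1) (a₂ := 0) (by simp [h]))
  let T (χ : DirichletCharacter ℂ N) : ℂ :=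
    (χ p * gaussSum χ⁻¹ ψ + χ (-p) * gaussSum χ⁻¹ ψ) / (2 * N)
  have hT1 : T 1 = -(1 / N) := by
    have h : IsUnit (p : ZMod N) := hp.isUnit
    simp only [T, inv_one, gaussSum_one_left hψ1, MulChar.one_apply h, MulChar.one_apply h.neg]
    field_simp
    norm_num
  have hsum : ∑ χ, T χ = (N - 1) / N * (Real.cos (2 * Real.pi * (p / N)) : ℂ) := by
    simp_rw [T]
    rw [← sum_div, sum_add_distrib, sum_char_mul_gaussSum_inv ψ hp,
      sum_char_mul_gaussSum_inv ψ (neg_ne_zero.2 hp), ← mul_add,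
      stdAddChar_inv_add_stdAddChar_inv_neg, Nat.totient_prime hN, Nat.cast_sub hN.one_le]
    field_simp
    push_cast
    ring
  classical
  have hT (χ : DirichletCharacter ℂ N) :
      {χ : DirichletCharacter ℂ N | χ.IsPrimitive ∧ χ (-1) = 1}.indicator
        (fun χ ↦ χ (p : ZMod N) / gaussSum' χ) χ = T χ + if χ = 1 then 1 / (N : ℂ) else 0 := by
    rcases eq_or_ne χ 1 with rfl | hχ
    · rw [Set.indicator_of_notMem fun h ↦ (isPrimitive_iff_ne_one hN _).1 h.1 rfl, hT1,
        if_pos rfl, neg_add_cancel]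
    rw [if_neg hχ, add_zero]
    rcases χ.even_or_odd with h | h
    · have hmem : χ ∈ {χ : DirichletCharacter ℂ N | χ.IsPrimitive ∧ χ (-1) = 1} :=
        ⟨(isPrimitive_iff_ne_one hN _).2 hχ, h⟩
      rw [Set.indicator_of_mem hmem, gaussSum'_eq_gaussSum, div_eq_mul_inv,
        inv_gaussSum_stdAddChar hχ]
      simp only [T, h.eval_neg]
      field_simp
      ring
    · have h1 : χ (-1) ≠ 1 := by
        rw [h]
        norm_num
      rw [Set.indicator_of_notMem fun h' ↦ h1 h'.2]
      simp [T, h.eval_neg]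
  rw [← hsum, finsum_mem_def, finsum_eq_sum_of_fintype]
  simp_rw [hT]
  rw [sum_add_distrib, sum_ite_eq' univ, if_pos (mem_univ _)]

lemma finsum_even_primitive_self {N : ℕ} (hN : N.Prime) :
    ∑ᶠ χ ∈ {χ : DirichletCharacter ℂ N | χ.IsPrimitive ∧ χ (-1) = 1},
        χ (N : ZMod N) / gaussSum' χ = 0 := by
  have : Fact N.Prime := ⟨hN⟩
  simp [MulChar.map_zero]

lemma norm_finsum_even_primitive_sub_cos_le {N p : ℕ} (hN : N.Prime) (hp : p.Prime) :
    ‖∑ᶠ χ ∈ {χ : DirichletCharacter ℂ N | χ.IsPrimitive ∧ χ (-1) = 1},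
        χ (p : ZMod N) / gaussSum' χ - (Real.cos (2 * Real.pi * (p / N)) : ℂ)‖ ≤
      2 / N + if N = p then 1 else 0 := by
  have hN0 : (0 : ℝ) < N := by exact_mod_cast hN.pos
  have hN0' : (N : ℂ) ≠ 0 := by exact_mod_cast hN.ne_zero
  have hcos := Real.abs_cos_le_one (2 * Real.pi * (p / N))
  split_ifs with h
  · subst h
    rw [finsum_even_primitive_self hN, zero_sub, norm_neg, Complex.norm_real, Real.norm_eq_abs]
    linarith [div_pos two_pos hN0]
  · have hp0 : (p : ZMod N) ≠ 0 := by
      rwa [Ne, ZMod.natCast_eq_zero_iff, Nat.prime_dvd_prime_iff_eq hN hp]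
    rw [finsum_even_primitive_eq hN hp0]
    set c := Real.cos (2 * Real.pi * (p / N))
    have : ((N : ℂ) - 1) / N * c + 1 / N - c = ((1 - c) / N : ℝ) := by
      push_cast
      field_simp
      ring
    rw [this, Complex.norm_real, Real.norm_eq_abs, abs_div, abs_of_pos hN0, add_zero]
    gcongr
    rw [abs_le] at hcos ⊢
    constructor <;> linarith

lemma tendsto_leastPrime_mul_div (hRH : RiemannHypothesis') {y : ℝ} (hy : 0 < y) :
    Tendsto (fun X : ℝ ↦ (leastPrime (y * X) : ℝ) / X) atTop (𝓝 y) := by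
  have h := ((tendsto_leastPrime_div hRH).comp (tendsto_id.const_mul_atTop hy)).mul_const y
  rw [one_mul] at h
  refine h.congr' ?_
  filter_upwards [eventually_gt_atTop 0] with X hX
  simp only [Function.comp_apply, id]
  field_simp

lemma abs_div_sub_le_of_mem_shortIntervalPrimes {X δ p y : ℝ} {N : ℕ} (hX : 0 < X) (hp : 0 ≤ p)
    (hN : N ∈ shortIntervalPrimes X δ) :
    |p / N - y| ≤ |p / X - y| + p / X * X ^ (δ - 1) := by
  rw [mem_shortIntervalPrimes] at hN
  have hN0 : (0 : ℝ) < N := hX.trans_le hN.2.1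
  have h : |p / N - p / X| ≤ p / X * X ^ (δ - 1) := by
    rw [abs_sub_comm, abs_of_nonneg (sub_nonneg.2 (by gcongr; exact hN.2.1)),
      Real.rpow_sub_one hX.ne']
    calc p / X - p / N = p / X * ((N - X) / N) := by field_simp
      _ ≤ p / X * (X ^ δ / X) := by
        gcongr
        · linarith
        · exact hN.2.1
  calc |p / N - y| = |(p / N - p / X) + (p / X - y)| := by ring_nf
    _ ≤ _ := by
      refine (abs_add_le _ _).trans ?_
      linarith

lemma norm_finsum_even_primitive_sub_cos_le_of_mem {X δ y : ℝ} {N p : ℕ} (hX : 0 < X)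
    (hp : p.Prime) (hN : N ∈ shortIntervalPrimes X δ) :
    ‖∑ᶠ χ ∈ {χ : DirichletCharacter ℂ N | χ.IsPrimitive ∧ χ (-1) = 1},
        χ (p : ZMod N) / gaussSum' χ - (Real.cos (2 * Real.pi * y) : ℂ)‖ ≤
      2 / X + 2 * Real.pi * (|p / X - y| + p / X * X ^ (δ - 1)) + if N = p then 1 else 0 := by
  have h1 := abs_div_sub_le_of_mem_shortIntervalPrimes (y := y) hX (Nat.cast_nonneg p) hN
  rw [mem_shortIntervalPrimes] at hN
  have h2 := norm_finsum_even_primitive_sub_cos_le hN.1 hp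
  have h3 : 2 / (N : ℝ) ≤ 2 / X := by
    gcongr
    exact hN.2.1
  have h4 : ‖(Real.cos (2 * Real.pi * (p / N)) : ℂ) - (Real.cos (2 * Real.pi * y) : ℂ)‖ ≤
      2 * Real.pi * |p / N - y| := by
    rw [← Complex.ofReal_sub, Complex.norm_real, Real.norm_eq_abs]
    refine (Real.abs_cos_sub_cos_le _ _).trans_eq ?_
    rw [← mul_sub, abs_mul, abs_of_pos Real.two_pi_pos]
  have h5 := mul_le_mul_of_nonneg_left h1 Real.two_pi_pos.le
  refine (norm_sub_le_norm_sub_add_norm_sub _ _ _).trans (add_le_add h2 h4) |>.trans ?_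
  linarith

theorem murmuration_PplusTilde (hRH : RiemannHypothesis') (y δ : ℝ) (hy : 0 < y)
    (hδ : δ ∈ Set.Ioo (1 / 2 : ℝ) 1) :
    Tendsto (fun X : ℝ => PplusTilde y X δ) atTop
      (𝓝 (Complex.ofReal (Real.cos (2 * Real.pi * y)))) := by
  set c : ℂ := Complex.ofReal (Real.cos (2 * Real.pi * y)) with hc
  let T (X : ℝ) (N : ℕ) : ℂ :=
    ∑ᶠ χ ∈ {χ : DirichletCharacter ℂ N | χ.IsPrimitive ∧ χ (-1) = 1},
      χ ((leastPrime (y * X) : ℕ) : ZMod N) / gaussSum' χ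
  have hcard := tendsto_log_div_mul_card_shortIntervalPrimes hRH hδ.1 hδ.2
  have hratio := tendsto_leastPrime_mul_div hRH hy
  let η (X : ℝ) : ℝ := 2 / X + 2 * Real.pi *
    (|leastPrime (y * X) / X - y| + leastPrime (y * X) / X * X ^ (δ - 1))
  have hη : Tendsto η atTop (𝓝 0) := by
    have h1 : Tendsto (fun X : ℝ ↦ X ^ (δ - 1)) atTop (𝓝 0) := by
      simpa using tendsto_rpow_neg_atTop (sub_pos.2 hδ.2)
    have h2 := (hratio.sub_const y).abs.add (hratio.mul h1)
    simpa using (tendsto_const_nhds.div_atTop tendsto_id).add (h2.const_mul (2 * Real.pi))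
  have hlog : Tendsto (fun X : ℝ ↦ Real.log X / X ^ δ) atTop (𝓝 0) :=
    (isLittleO_log_rpow_atTop (by linarith [hδ.1])).tendsto_div_nhds_zero
  have hbound : Tendsto (fun X : ℝ ↦ Real.log X / X ^ δ * #(shortIntervalPrimes X δ) * η X +
      Real.log X / X ^ δ) atTop (𝓝 0) := by
    simpa using (hcard.mul hη).add hlog
  have herr : Tendsto (fun X : ℝ ↦ (Complex.ofReal (Real.log X / X ^ δ)) *
      ∑ N ∈ shortIntervalPrimes X δ, (T X N - c)) atTop (𝓝 0) := by
    refine squeeze_zero_norm' ?_ hbound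
    filter_upwards [eventually_ge_atTop 1] with X hX
    have hX0 : 0 < X := by linarith
    have hpos : 0 ≤ Real.log X / X ^ δ := div_nonneg (Real.log_nonneg hX) (by positivity)
    have hsum : ‖∑ N ∈ shortIntervalPrimes X δ, (T X N - c)‖ ≤
        #(shortIntervalPrimes X δ) * η X + 1 := by
      refine (norm_sum_le_of_le _ fun N hN ↦ norm_finsum_even_primitive_sub_cos_le_of_mem hX0
        (leastPrime_spec (y * X)).1 hN).trans ?_
      rw [sum_add_distrib, sum_const, nsmul_eq_mul, sum_ite_eq']
      gcongr
      split_ifs <;> norm_num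
    rw [norm_mul, Complex.norm_real, Real.norm_eq_abs, abs_of_nonneg hpos]
    calc _ ≤ Real.log X / X ^ δ * (#(shortIntervalPrimes X δ) * η X + 1) := by gcongr
      _ = _ := by ring
  have hmain := herr.add (((Complex.continuous_ofReal.tendsto 1).comp hcard).mul_const c)
  rw [Complex.ofReal_one, one_mul, zero_add] at hmain
  refine hmain.congr fun X ↦ ?_
  rw [sum_sub_distrib, sum_const, nsmul_eq_mul, Function.comp_apply, Complex.ofReal_mul,
    Complex.ofReal_natCast, mul_sub, mul_assoc, sub_add_cancel]
  rfl
end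

section
/- Assume the Generalized Riemann hypothesis. Let Φ : ℝ → ℝ be a Schwartz function with compact support satisfying Φ ≥ 0, and define F(y) = (1/2) · Σ_{a ≥ 1, a odd} (μ(a)/a²) · Σ_{m ≥ 1} (−1)^m · Φ̃(m²/(2a²y)) for y > 0. Then lim_{y → 0⁺} F(y) = 0 and lim_{y → ∞} F(y) = −(2/π²) · Φ̃(0). -/
open Filter Topology Finset

/-- The Generalized Riemann hypothesis: for every positive modulus `q` and every
Dirichlet character `χ` mod `q`, every zero of `L(s, χ)` with real part strictly
between `0` and `1` has real part `1/2`. -/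
def GeneralizedRiemannHypothesis : Prop :=
  ∀ (q : ℕ) [NeZero q] (χ : DirichletCharacter ℂ q) (s : ℂ),
    DirichletCharacter.LFunction χ s = 0 → 0 < s.re → s.re < 1 → s.re = 1 / 2

/-- The transform `Φ̃(ξ) = ∫ (cos(2πξx) + sin(2πξx)) Φ(x) dx`. -/
noncomputable def cosSinTransform (Φ : ℝ → ℝ) (ξ : ℝ) : ℝ :=
  ∫ x : ℝ, (Real.cos (2 * Real.pi * ξ * x) + Real.sin (2 * Real.pi * ξ * x)) * Φ x

/-- The murmuration density
`F(y) = (1/2) Σ_{a odd} (μ(a)/a²) Σ_{m ≥ 1} (−1)^m Φ̃(m²/(2a²y))`. -/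
noncomputable def murmurationDensity (Φ : ℝ → ℝ) (y : ℝ) : ℝ :=
  (1 / 2) * ∑' a : ℕ,
    (if Odd a then (ArithmeticFunction.moebius a : ℝ) / (a : ℝ) ^ 2 else 0) *
      ∑' m : ℕ, (-1 : ℝ) ^ (m + 1) *
        cosSinTransform Φ (((m : ℝ) + 1) ^ 2 / (2 * (a : ℝ) ^ 2 * y))

theorem SchwartzMap.exists_bound_pow_mul (f : SchwartzMap ℝ ℝ) (k : ℕ) :
    ∃ C, 0 < C ∧ ∀ x, |x| ^ k * |f x| ≤ C := by
  obtain ⟨C, hC, h⟩ := f.decay k 0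
  exact ⟨C, hC, fun x => by simpa using h x⟩

theorem summable_inv_succ_rpow {p : ℝ} (hp : 1 < p) :
    Summable fun m : ℕ => (((m : ℝ) + 1) ^ p)⁻¹ := by
  have h := (summable_nat_add_iff 1).2 (Real.summable_nat_rpow_inv.2 hp)
  simpa using h

/-- The alternating sum `Σ_{m ≥ 1} (-1)^m f(m t)`. -/
noncomputable def alternatingSum (f : ℝ → ℝ) (t : ℝ) : ℝ :=
  ∑' m : ℕ, (-1 : ℝ) ^ (m + 1) * f (((m : ℝ) + 1) * t)

theorem SchwartzMap.exists_norm_apply_succ_mul_le (f : SchwartzMap ℝ ℝ) :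
    ∃ C, 0 < C ∧ ∀ t : ℝ, 0 < t → ∀ m : ℕ,
      |f (((m : ℝ) + 1) * t)| ≤ C * (t ^ 2)⁻¹ * (((m : ℝ) + 1) ^ (2 : ℝ))⁻¹ := by
  obtain ⟨C, hC, h⟩ := f.exists_bound_pow_mul 2
  refine ⟨C, hC, fun t ht m => ?_⟩
  have hm : (0 : ℝ) < (m : ℝ) + 1 := by positivity
  have := h (((m : ℝ) + 1) * t)
  rw [sq_abs, mul_comm, ← le_div_iff₀ (by positivity)] at this
  refine this.trans_eq ?_
  rw [Real.rpow_two]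
  field_simp

theorem SchwartzMap.summable_abs_apply_succ_mul (f : SchwartzMap ℝ ℝ) {t : ℝ} (ht : 0 < t) :
    Summable fun m : ℕ => |f (((m : ℝ) + 1) * t)| := by
  obtain ⟨C, -, h⟩ := f.exists_norm_apply_succ_mul_le
  exact Summable.of_nonneg_of_le (fun _ => abs_nonneg _) (h t ht)
    ((summable_inv_succ_rpow one_lt_two).mul_left _)

theorem SchwartzMap.exists_abs_alternatingSum_le_inv_sq (f : SchwartzMap ℝ ℝ) :
    ∃ C, 0 < C ∧ ∀ t : ℝ, 0 < t → |alternatingSum f t| ≤ C * (t ^ 2)⁻¹ := by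
  obtain ⟨C, hC, h⟩ := f.exists_norm_apply_succ_mul_le
  have hs := summable_inv_succ_rpow one_lt_two
  refine ⟨C * ∑' m : ℕ, (((m : ℝ) + 1) ^ (2 : ℝ))⁻¹,
    mul_pos hC (hs.tsum_pos (fun _ => by positivity) 0 (by positivity)), fun t ht => ?_⟩
  have := tsum_of_norm_bounded (hs.mul_left (C * (t ^ 2)⁻¹)).hasSum
    (f := fun m : ℕ => (-1 : ℝ) ^ (m + 1) * f (((m : ℝ) + 1) * t))
    (fun m => by simpa using h t ht m)
  rw [tsum_mul_left] at this
  exact this.trans_eq (by ring)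

/-- Second differences are controlled by the second derivative. -/
theorem abs_second_difference_le {f : ℝ → ℝ} (hf : ContDiff ℝ 2 f) {x t K : ℝ} (ht : 0 ≤ t)
    (hK : ∀ y, x ≤ y → |deriv (deriv f) y| ≤ K) :
    |f x - 2 * f (x + t) + f (x + 2 * t)| ≤ K * t ^ 2 := by
  have hd : Differentiable ℝ f := hf.differentiable (by norm_num)
  have hd' : Differentiable ℝ (deriv f) := by
    have := hf.iterate_deriv' 1 1
    exact this.differentiable (by norm_num)
  have h1 : ∀ y ∈ Set.Ici x, ‖deriv f (y + t) - deriv f y‖ ≤ K * t := fun y hy => by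
    have := Convex.norm_image_sub_le_of_norm_deriv_le (f := deriv f) (s := Set.Ici x) (C := K)
      (fun z _ => hd' z) (fun z hz => hK z hz) (convex_Ici x) hy
      (show y + t ∈ Set.Ici x from le_add_of_le_of_nonneg hy ht)
    simpa [abs_of_nonneg ht] using this
  have hder : ∀ y, HasDerivAt (fun y => f (y + t) - f y) (deriv f (y + t) - deriv f y) y :=
    fun y => ((hd (y + t)).hasDerivAt.comp_add_const y t).sub (hd y).hasDerivAt
  have := (convex_Ici x).norm_image_sub_le_of_norm_hasDerivWithin_le
    (fun y _ => (hder y).hasDerivWithinAt) h1 (Set.self_mem_Ici)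
      (show x + t ∈ Set.Ici x from le_add_of_nonneg_right ht)
  simp only [add_sub_cancel_left, Real.norm_eq_abs, abs_of_nonneg ht] at this
  calc _ = |f (x + t + t) - f (x + t) - (f (x + t) - f x)| := by
        congr 1; rw [show x + t + t = x + 2 * t by ring]; ring
    _ ≤ K * t * t := this
    _ = K * t ^ 2 := by ring

theorem tsum_alternating_eq {b : ℕ → ℝ} (hb : Summable b) :
    ∑' m : ℕ, (-1 : ℝ) ^ m * b m =
      b 0 / 2 + (b 0 - b 1) / 4 +
        (∑' m : ℕ, (-1 : ℝ) ^ m * (b m - 2 * b (m + 1) + b (m + 2))) / 4 := by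
  have h0 : Summable fun m : ℕ => (-1 : ℝ) ^ m * b m :=
    Summable.of_norm (by simpa using hb.abs)
  have h1 := (summable_nat_add_iff 1).2 h0
  have h2 := (summable_nat_add_iff 2).2 h0
  have e0 := h0.tsum_eq_zero_add
  have e1 := h1.tsum_eq_zero_add
  have : ∑' m : ℕ, (-1 : ℝ) ^ m * (b m - 2 * b (m + 1) + b (m + 2)) =
      ∑' m : ℕ, (-1 : ℝ) ^ m * b m + 2 * ∑' m : ℕ, (-1 : ℝ) ^ (m + 1) * b (m + 1) +
        ∑' m : ℕ, (-1 : ℝ) ^ (m + 2) * b (m + 2) := by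
    rw [← tsum_mul_left, ← h0.tsum_add (h1.mul_left 2), ← (h0.add (h1.mul_left 2)).tsum_add h2]
    exact tsum_congr fun m => by ring
  simp only [pow_zero, zero_add, one_mul, pow_one, add_assoc, Nat.reduceAdd] at e0 e1
  rw [this]
  linarith

theorem SchwartzMap.exists_abs_deriv_deriv_le (f : SchwartzMap ℝ ℝ) :
    ∃ K, 0 < K ∧ ∀ x, 0 < x → ∀ y, x ≤ y →
      |deriv (deriv f) y| ≤ K * (x ^ (3 / 2 : ℝ))⁻¹ := by
  set g := SchwartzMap.derivCLM ℝ ℝ (SchwartzMap.derivCLM ℝ ℝ f) with hg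
  have hgd : ∀ y, g y = deriv (deriv f) y := fun y => by
    rw [hg, SchwartzMap.derivCLM_apply]
    congr 1
  obtain ⟨A, hA, hA'⟩ := g.exists_bound_pow_mul 0
  obtain ⟨B, hB, hB'⟩ := g.exists_bound_pow_mul 2
  refine ⟨A + B, by positivity, fun x hx y hxy => ?_⟩
  have hy : 0 < y := hx.trans_le hxy
  rw [← div_eq_mul_inv, le_div_iff₀ (by positivity), ← hgd]
  have h1 := hA' y
  have h2 := hB' y
  rw [pow_zero, one_mul] at h1
  rw [sq_abs] at h2
  have h3 : x ^ (3 / 2 : ℝ) ≤ 1 + y ^ 2 := by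
    refine (Real.rpow_le_rpow hx.le hxy (by norm_num)).trans ?_
    rcases le_total y 1 with h | h
    · nlinarith [Real.rpow_le_one hy.le h (show (0 : ℝ) ≤ 3 / 2 by norm_num)]
    · have := Real.rpow_le_rpow_of_exponent_le h (show (3 / 2 : ℝ) ≤ 2 by norm_num)
      rw [Real.rpow_two] at this
      linarith
  nlinarith [mul_le_mul_of_nonneg_left h3 (abs_nonneg (g y))]

theorem SchwartzMap.exists_abs_alternatingSum_add_le (f : SchwartzMap ℝ ℝ) :
    ∃ C, 0 < C ∧ ∀ t : ℝ, 0 < t →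
      |alternatingSum f t + (f t / 2 + (f t - f (2 * t)) / 4)| ≤ C * t ^ (1 / 2 : ℝ) := by
  obtain ⟨K, hK, h⟩ := f.exists_abs_deriv_deriv_le
  have hs := summable_inv_succ_rpow (show (1 : ℝ) < 3 / 2 by norm_num)
  refine ⟨K * ∑' m : ℕ, (((m : ℝ) + 1) ^ (3 / 2 : ℝ))⁻¹,
    mul_pos hK (hs.tsum_pos (fun _ => by positivity) 0 (by positivity)), fun t ht => ?_⟩
  set b : ℕ → ℝ := fun m => f (((m : ℝ) + 1) * t) with hb
  have hsum : Summable b := (f.summable_abs_apply_succ_mul ht).of_abs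
  have hneg : alternatingSum f t = -∑' m : ℕ, (-1 : ℝ) ^ m * b m := by
    rw [alternatingSum, ← tsum_neg]
    exact tsum_congr fun m => by rw [hb]; ring
  have hdiff : ∀ m : ℕ, ‖(-1 : ℝ) ^ m * (b m - 2 * b (m + 1) + b (m + 2))‖ ≤
      K * t ^ (1 / 2 : ℝ) * (((m : ℝ) + 1) ^ (3 / 2 : ℝ))⁻¹ := fun m => by
    have hm : (0 : ℝ) < (m : ℝ) + 1 := by positivity
    have := abs_second_difference_le (f.smooth 2) ht.le (h (((m : ℝ) + 1) * t) (by positivity))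
    simp only [norm_mul, norm_pow, norm_neg, norm_one, one_pow, one_mul, Real.norm_eq_abs]
    convert this using 1
    · simp only [hb]
      push_cast
      ring_nf
    · rw [Real.mul_rpow hm.le ht.le]
      have : t ^ 2 = t ^ (1 / 2 : ℝ) * t ^ (3 / 2 : ℝ) := by
        rw [← Real.rpow_add ht, ← Real.rpow_two]; norm_num
      rw [this]
      field_simp
  have hbd := tsum_of_norm_bounded (hs.mul_left (K * t ^ (1 / 2 : ℝ))).hasSum hdiff
  rw [tsum_mul_left, Real.norm_eq_abs] at hbd
  have e0 : b 0 = f t := by simp [hb]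
  have e1 : b 1 = f (2 * t) := by simp [hb, one_add_one_eq_two]
  rw [hneg, tsum_alternating_eq hsum, e0, e1]
  set T := ∑' m : ℕ, (-1 : ℝ) ^ m * (b m - 2 * b (m + 1) + b (m + 2))
  rw [show -(f t / 2 + (f t - f (2 * t)) / 4 + T / 4) + (f t / 2 + (f t - f (2 * t)) / 4) =
    -(T / 4) by ring, abs_neg, abs_div, abs_of_pos (show (0 : ℝ) < 4 by norm_num)]
  linarith [abs_nonneg T]

theorem SchwartzMap.tendsto_alternatingSum_zero (f : SchwartzMap ℝ ℝ) :
    Tendsto (alternatingSum f) (𝓝[>] 0) (𝓝 (-(f 0 / 2))) := by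
  obtain ⟨C, hC, h⟩ := f.exists_abs_alternatingSum_add_le
  have hpow : Tendsto (fun t : ℝ => C * t ^ (1 / 2 : ℝ)) (𝓝[>] 0) (𝓝 0) := by
    have : ContinuousAt (fun t : ℝ => C * t ^ (1 / 2 : ℝ)) 0 :=
      continuousAt_const.mul (Real.continuousAt_rpow_const 0 _ (Or.inr (by norm_num)))
    have := this.tendsto
    rw [Real.zero_rpow (by norm_num), mul_zero] at this
    exact this.mono_left nhdsWithin_le_nhds
  have h1 : Tendsto (fun t => alternatingSum f t + (f t / 2 + (f t - f (2 * t)) / 4))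
      (𝓝[>] 0) (𝓝 0) :=
    squeeze_zero_norm' (eventually_mem_nhdsWithin.mono fun t ht => h t ht) hpow
  have h2 : Tendsto (fun t => f t / 2 + (f t - f (2 * t)) / 4) (𝓝[>] 0) (𝓝 (f 0 / 2)) := by
    have hc : Continuous fun t => f t / 2 + (f t - f (2 * t)) / 4 := by
      have := f.continuous
      fun_prop
    have := hc.tendsto 0
    simp only [mul_zero, sub_self, zero_div, add_zero] at this
    exact this.mono_left nhdsWithin_le_nhds
  simpa using h1.sub h2

theorem SchwartzMap.tendsto_alternatingSum_atTop (f : SchwartzMap ℝ ℝ) :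
    Tendsto (alternatingSum f) atTop (𝓝 0) := by
  obtain ⟨C, hC, h⟩ := f.exists_abs_alternatingSum_le_inv_sq
  refine squeeze_zero_norm' ((eventually_gt_atTop 0).mono fun t ht => h t ht) ?_
  have := (tendsto_inv_atTop_zero.comp (tendsto_pow_atTop (α := ℝ) two_ne_zero)).const_mul C
  simpa using this

theorem SchwartzMap.exists_abs_alternatingSum_le (f : SchwartzMap ℝ ℝ) :
    ∃ M, 0 < M ∧ ∀ t : ℝ, 0 < t → |alternatingSum f t| ≤ M := by
  obtain ⟨A, hA, hA'⟩ := f.exists_abs_alternatingSum_le_inv_sq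
  obtain ⟨C, hC, hC'⟩ := f.exists_abs_alternatingSum_add_le
  obtain ⟨B, hB, hB'⟩ := f.exists_bound_pow_mul 0
  simp only [pow_zero, one_mul] at hB'
  refine ⟨A + B + C, by positivity, fun t ht => ?_⟩
  rcases le_total t 1 with h | h
  · have h1 := hC' t ht
    have h2 : t ^ (1 / 2 : ℝ) ≤ 1 := Real.rpow_le_one ht.le h (by norm_num)
    have h3 := abs_le.1 (hB' t)
    have h4 := abs_le.1 (hB' (2 * t))
    have h5 := abs_le.1 (h1.trans (mul_le_of_le_one_right hC.le h2))
    exact abs_le.2 ⟨by linarith, by linarith⟩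
  · have h1 := hA' t ht
    have h2 : (t ^ 2)⁻¹ ≤ 1 := inv_le_one_of_one_le₀ (one_le_pow₀ h)
    linarith [mul_le_of_le_one_right hA.le h2]

theorem exists_schwartzMap_eq_cosSinTransform_sq {Φ : ℝ → ℝ} (hΦ : ContDiff ℝ (⊤ : ℕ∞) Φ)
    (hΦsupp : HasCompactSupport Φ) :
    ∃ f : SchwartzMap ℝ ℝ, ∀ u, f u = cosSinTransform Φ (u ^ 2) := by
  have hcs : HasCompactSupport fun x => (Φ x : ℂ) :=
    hΦsupp.comp_left (g := Complex.ofReal) Complex.ofReal_zero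
  obtain ⟨ψ, hψΦ⟩ : ∃ ψ : SchwartzMap ℝ ℂ, (ψ : ℝ → ℂ) = fun x => (Φ x : ℂ) :=
    ⟨hcs.toSchwartzMap (Complex.ofRealCLM.contDiff.comp hΦ), rfl⟩
  obtain ⟨L, hL⟩ : ∃ L : ℂ →L[ℝ] ℝ, ∀ z, L z = z.re - z.im :=
    ⟨Complex.reCLM - Complex.imCLM, fun _ => rfl⟩
  have hsq : Function.HasTemperateGrowth fun u : ℝ => u ^ 2 :=
    (Function.HasTemperateGrowth.id' (E := ℝ)).pow 2
  refine ⟨SchwartzMap.compCLM ℝ hsq ⟨1, 1, fun x => ?_⟩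
    ((FourierTransform.fourier ψ).postcompCLM L), fun u => ?_⟩
  · simp only [Real.norm_eq_abs, abs_pow, sq_abs, pow_one, one_mul]
    nlinarith [sq_nonneg (|x| - 1), sq_abs x]
  · have hψ : MeasureTheory.Integrable fun v : ℝ =>
        Complex.exp (((-2 * Real.pi * v * u ^ 2 : ℝ) : ℂ) * Complex.I) • (Φ v : ℂ) := by
      have hc := hΦ.continuous
      refine Continuous.integrable_of_hasCompactSupport (by fun_prop) (hcs.mono fun v hv => ?_)
      exact right_ne_zero_of_smul hv
    simp only [SchwartzMap.compCLM_apply, Function.comp_apply, SchwartzMap.postcompCLM_apply]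
    rw [SchwartzMap.fourier_coe, Real.fourier_real_eq_integral_exp_smul, hψΦ,
      ← L.integral_comp_comm hψ, cosSinTransform]
    refine MeasureTheory.integral_congr_ae (Eventually.of_forall fun v => ?_)
    have harg : -2 * Real.pi * v * u ^ 2 = -(2 * Real.pi * u ^ 2 * v) := by ring
    simp [hL, harg, Complex.exp_ofReal_mul_I_re, Complex.exp_ofReal_mul_I_im, -Complex.ofReal_neg,
      -Complex.ofReal_mul, -Complex.ofReal_pow, -neg_mul]
    ring

theorem abs_moebius_div_sq_le (a : ℕ) :
    |if Odd a then (ArithmeticFunction.moebius a : ℝ) / (a : ℝ) ^ 2 else 0| ≤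
      ((a : ℝ) ^ 2)⁻¹ := by
  split_ifs
  · have : |(ArithmeticFunction.moebius a : ℝ)| ≤ 1 := by
      exact_mod_cast ArithmeticFunction.abs_moebius_le_one
    rw [abs_div, abs_of_nonneg (sq_nonneg (a : ℝ)), div_eq_mul_inv]
    exact mul_le_of_le_one_left (by positivity) this
  · simp

theorem tsum_odd_moebius_div_sq :
    ∑' a : ℕ, (if Odd a then (ArithmeticFunction.moebius a : ℝ) / (a : ℝ) ^ 2 else 0) =
      8 / Real.pi ^ 2 := by
  have h2 : (1 : ℝ) < (2 : ℂ).re := by norm_num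
  have hL := DirichletCharacter.LSeries.mul_mu_eq_one (1 : DirichletCharacter ℂ 2) h2
  rw [← DirichletCharacter.LFunction_eq_LSeries _ h2] at hL
  have hT := DirichletCharacter.LFunctionTrivChar_eq_mul_riemannZeta (N := 2) (s := 2)
    (by norm_num)
  rw [DirichletCharacter.LFunctionTrivChar] at hT
  rw [hT, riemannZeta_two, Nat.prime_two.primeFactors, Finset.prod_singleton] at hL
  have hp : ((2 : ℕ) : ℂ) ^ (-(2 : ℂ)) = 1 / 4 := by
    rw [Complex.cpow_neg, Complex.cpow_ofNat]; norm_num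
  rw [hp] at hL
  rw [LSeries] at hL
  have hterm : ∀ a : ℕ, LSeries.term
      ((fun n : ℕ => (1 : DirichletCharacter ℂ 2) n) *
        fun n : ℕ => (ArithmeticFunction.moebius n : ℂ)) 2 a =
      ((if Odd a then (ArithmeticFunction.moebius a : ℝ) / (a : ℝ) ^ 2 else 0 : ℝ) : ℂ) := by
    intro a
    rcases eq_or_ne a 0 with rfl | ha
    · simp
    rw [LSeries.term_of_ne_zero ha, Pi.mul_apply, Complex.cpow_ofNat]
    split_ifs with h
    · have hu : IsUnit (a : ZMod 2) := (ZMod.isUnit_iff_coprime a 2).2 h.coprime_two_right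
      rw [MulChar.one_apply hu]
      push_cast
      ring
    · have hu : ¬ IsUnit (a : ZMod 2) := fun hu =>
        h (Nat.coprime_two_right.1 ((ZMod.isUnit_iff_coprime a 2).1 hu))
      rw [MulChar.map_nonunit _ hu]
      simp
  rw [tsum_congr hterm, ← Complex.ofReal_tsum] at hL
  set S := ∑' a : ℕ, (if Odd a then (ArithmeticFunction.moebius a : ℝ) / (a : ℝ) ^ 2 else 0)
  have hL' : (1 - 1 / 4) * (Real.pi ^ 2 / 6) * S = 1 := by
    apply Complex.ofReal_injective
    push_cast at hL ⊢
    exact hL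
  rw [eq_div_iff (by positivity)]
  linarith

theorem murmurationDensity_eq_tsum_alternatingSum {Φ : ℝ → ℝ} {f : ℝ → ℝ}
    (hf : ∀ u, f u = cosSinTransform Φ (u ^ 2)) {y : ℝ} (hy : 0 < y) :
    murmurationDensity Φ y = (1 / 2) * ∑' a : ℕ,
      (if Odd a then (ArithmeticFunction.moebius a : ℝ) / (a : ℝ) ^ 2 else 0) *
        alternatingSum f (a * √(2 * y))⁻¹ := by
  rw [murmurationDensity]
  congr 1
  refine tsum_congr fun a => ?_
  congr 1
  refine tsum_congr fun m => ?_
  rw [hf, mul_pow, inv_pow, mul_pow, Real.sq_sqrt (by positivity), div_eq_mul_inv]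
  congr 4
  ring

theorem SchwartzMap.tendsto_tsum_moebius_mul_alternatingSum (f : SchwartzMap ℝ ℝ) {l : Filter ℝ}
    {c : ℝ} (hl : ∀ᶠ y in l, 0 < y)
    (h : ∀ a : ℕ, 0 < a →
      Tendsto (fun y => alternatingSum f (a * √(2 * y))⁻¹) l (𝓝 c)) :
    Tendsto (fun y => (1 / 2) * ∑' a : ℕ,
      (if Odd a then (ArithmeticFunction.moebius a : ℝ) / (a : ℝ) ^ 2 else 0) *
        alternatingSum f (a * √(2 * y))⁻¹) l (𝓝 (4 / Real.pi ^ 2 * c)) := by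
  obtain ⟨M, hM, hM'⟩ := f.exists_abs_alternatingSum_le
  have hlim := tendsto_tsum_of_dominated_convergence (𝓕 := l)
    (f := fun y (a : ℕ) =>
      (if Odd a then (ArithmeticFunction.moebius a : ℝ) / (a : ℝ) ^ 2 else 0) *
        alternatingSum f (a * √(2 * y))⁻¹)
    (g := fun a : ℕ =>
      (if Odd a then (ArithmeticFunction.moebius a : ℝ) / (a : ℝ) ^ 2 else 0) * c)
    (bound := fun a : ℕ => ((a : ℝ) ^ 2)⁻¹ * M)
    ((Real.summable_nat_pow_inv.2 one_lt_two).mul_right M)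
    (fun a => ?_) (hl.mono fun y hy a => ?_)
  · rw [tsum_mul_right, tsum_odd_moebius_div_sq] at hlim
    convert hlim.const_mul (1 / 2) using 2
    ring
  · rcases Nat.eq_zero_or_pos a with rfl | ha
    · simpa using tendsto_const_nhds
    · exact (h a ha).const_mul _
  · rcases Nat.eq_zero_or_pos a with rfl | ha
    · simp
    · rw [norm_mul]
      exact mul_le_mul (abs_moebius_div_sq_le a) (hM' _ (by positivity)) (abs_nonneg _)
        (by positivity)

theorem one_level_density_interpolation (hGRH : GeneralizedRiemannHypothesis)
    (Φ : ℝ → ℝ) (hΦsmooth : ContDiff ℝ (⊤ : ℕ∞) Φ) (hΦsupp : HasCompactSupport Φ)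
    (hΦpos : ∀ x, 0 ≤ Φ x) :
    Tendsto (fun y : ℝ => murmurationDensity Φ y) (𝓝[>] 0) (𝓝 0) ∧
    Tendsto (fun y : ℝ => murmurationDensity Φ y) atTop
      (𝓝 (-(2 / Real.pi ^ 2) * cosSinTransform Φ 0)) := by
  obtain ⟨f, hf⟩ := exists_schwartzMap_eq_cosSinTransform_sq hΦsmooth hΦsupp
  have hsqrt : ContinuousAt (fun y : ℝ => √(2 * y)) 0 := by fun_prop
  constructor
  · have hpos : ∀ᶠ y : ℝ in 𝓝[>] 0, 0 < y := eventually_mem_nhdsWithin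
    have := f.tendsto_tsum_moebius_mul_alternatingSum hpos (c := 0) fun a ha =>
      f.tendsto_alternatingSum_atTop.comp <| tendsto_inv_nhdsGT_zero.comp <|
        tendsto_nhdsWithin_iff.2 ⟨by
          have h := (hsqrt.tendsto.const_mul (a : ℝ)).mono_left
            (nhdsWithin_le_nhds (s := Set.Ioi 0))
          simpa using h, hpos.mono fun y hy => Set.mem_Ioi.2 (by positivity)⟩
    rw [mul_zero] at this
    exact this.congr' (hpos.mono fun y hy => (murmurationDensity_eq_tsum_alternatingSum hf hy).symm)
  · have hpos : ∀ᶠ y : ℝ in atTop, 0 < y := eventually_gt_atTop 0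
    have := f.tendsto_tsum_moebius_mul_alternatingSum hpos (c := -(f 0 / 2)) fun a ha =>
      f.tendsto_alternatingSum_zero.comp <| tendsto_inv_atTop_nhdsGT_zero.comp <|
        (Real.tendsto_sqrt_atTop.comp (tendsto_id.const_mul_atTop two_pos)).const_mul_atTop
          (Nat.cast_pos.2 ha)
    rw [show 4 / Real.pi ^ 2 * -(f 0 / 2) = -(2 / Real.pi ^ 2) * cosSinTransform Φ 0 by
      rw [hf 0, zero_pow two_ne_zero]; ring] at this
    exact this.congr' (hpos.mono fun y hy => (murmurationDensity_eq_tsum_alternatingSum hf hy).symm)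
end
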